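/- Let Ω ⊂ ℝ² be a bounded convex open set containing (x₀,y₀), star-shaped about (x₀,y₀) with boundary function R(φ), and let B be the disk of radius R₀ with πR₀² = |Ω|. Then the ground state eigenvalues satisfy λ₁,Ω^ω(x₀,y₀) ≤ λ₁,B^ω(0,0) + (∫₀^{2π} (R'(φ)/R(φ))² dφ) · sup_{0 ≤ m ≤ (R₀²ω+√(R₀⁴ω²+4j_{0,1}²))/2} (j_{m,1}² - m²)/(2πR₀²). -/

import Mathlib

open MeasureTheory

/-- Partial derivative in the first coordinate direction. -/
noncomputable def dX (u : ℝ × ℝ → ℂ) (p : ℝ × ℝ) : ℂ := fderiv ℝ u p (1, 0)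

/-- Partial derivative in the second coordinate direction. -/
noncomputable def dY (u : ℝ × ℝ → ℂ) (p : ℝ × ℝ) : ℂ := fderiv ℝ u p (0, 1)

/-- The ground state energy of `H_{ω,Ω}(x₀,y₀) = -Δ_D^Ω + iω((x-x₀)∂_y - (y-y₀)∂_x)`,
defined variationally as the infimum of the Rayleigh quotients of smooth normalized trial
functions compactly supported in `Ω`. -/
noncomputable def groundEnergy (Ω : Set (ℝ × ℝ)) (ω x₀ y₀ : ℝ) : ℝ :=
  sInf {E : ℝ | ∃ u : ℝ × ℝ → ℂ, ContDiff ℝ (⊤ : ℕ∞) u ∧ HasCompactSupport u ∧ tsupport u ⊆ Ω ∧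
    (∫ p, ‖u p‖ ^ 2) = 1 ∧
    E = ∫ p, (‖dX u p‖ ^ 2 + ‖dY u p‖ ^ 2
      + (Complex.I * (ω : ℂ)
          * (((p.1 - x₀ : ℝ) : ℂ) * dY u p - ((p.2 - y₀ : ℝ) : ℂ) * dX u p)
          * (starRingEnd ℂ) (u p)).re)}

section
open MeasureTheory

noncomputable def eDens (ω x₀ y₀ : ℝ) (u : ℝ × ℝ → ℂ) (p : ℝ × ℝ) : ℝ :=
  ‖dX u p‖ ^ 2 + ‖dY u p‖ ^ 2
      + (Complex.I * (ω : ℂ)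
          * (((p.1 - x₀ : ℝ) : ℂ) * dY u p - ((p.2 - y₀ : ℝ) : ℂ) * dX u p)
          * (starRingEnd ℂ) (u p)).re

noncomputable def en (ω x₀ y₀ : ℝ) (u : ℝ × ℝ → ℂ) : ℝ := ∫ p, eDens ω x₀ y₀ u p

noncomputable def nrm (u : ℝ × ℝ → ℂ) : ℝ := ∫ p, ‖u p‖ ^ 2

lemma continuous_dX {u : ℝ × ℝ → ℂ} (hu : ContDiff ℝ 1 u) : Continuous (dX u) :=
  (hu.continuous_fderiv one_ne_zero).clm_apply continuous_const

lemma continuous_dY {u : ℝ × ℝ → ℂ} (hu : ContDiff ℝ 1 u) : Continuous (dY u) :=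
  (hu.continuous_fderiv one_ne_zero).clm_apply continuous_const

lemma hcs_dX {u : ℝ × ℝ → ℂ} (hc : HasCompactSupport u) : HasCompactSupport (dX u) :=
  hc.fderiv_apply ℝ _

lemma hcs_dY {u : ℝ × ℝ → ℂ} (hc : HasCompactSupport u) : HasCompactSupport (dY u) :=
  hc.fderiv_apply ℝ _

lemma continuous_eDens {u : ℝ × ℝ → ℂ} (hu : ContDiff ℝ 1 u) (ω x₀ y₀ : ℝ) :
    Continuous (eDens ω x₀ y₀ u) := by
  have h1 := continuous_dX hu
  have h2 := continuous_dY hu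
  have h3 := hu.continuous
  unfold eDens
  fun_prop

lemma zero_eDens {u : ℝ × ℝ → ℂ} (ω x₀ y₀ : ℝ) {p : ℝ × ℝ} (hp : p ∉ tsupport u) :
    eDens ω x₀ y₀ u p = 0 := by
  have h1 : fderiv ℝ u p = 0 := by
    have := support_fderiv_subset ℝ (f := u)
    by_contra h
    exact hp (this h)
  simp [eDens, dX, dY, h1]

lemma hcs_eDens {u : ℝ × ℝ → ℂ} (hc : HasCompactSupport u) (ω x₀ y₀ : ℝ) :
    HasCompactSupport (eDens ω x₀ y₀ u) :=
  HasCompactSupport.intro hc (fun _ hp => zero_eDens ω x₀ y₀ hp)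

lemma hcs_nsq {u : ℝ × ℝ → ℂ} (hc : HasCompactSupport u) :
    HasCompactSupport (fun p => ‖u p‖ ^ 2) :=
  HasCompactSupport.intro hc (fun p hp => by simp [image_eq_zero_of_notMem_tsupport hp])

lemma alg_lower (ω x y : ℝ) (a b c : ℂ) :
    -(ω ^ 2 / 4 * (x ^ 2 + y ^ 2)) * ‖c‖ ^ 2 ≤ ‖a‖ ^ 2 + ‖b‖ ^ 2
      + (Complex.I * (ω : ℂ) * ((x : ℂ) * b - (y : ℂ) * a) * (starRingEnd ℂ) c).re := by
  rw [← Complex.normSq_eq_norm_sq, ← Complex.normSq_eq_norm_sq, ← Complex.normSq_eq_norm_sq]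
  simp only [Complex.normSq_apply, Complex.mul_re, Complex.mul_im, Complex.I_re, Complex.I_im,
    Complex.ofReal_re, Complex.ofReal_im, Complex.sub_re, Complex.sub_im, Complex.conj_re,
    Complex.conj_im]
  nlinarith [sq_nonneg (a.re - ω / 2 * y * c.im), sq_nonneg (a.im + ω / 2 * y * c.re),
    sq_nonneg (b.re + ω / 2 * x * c.im), sq_nonneg (b.im - ω / 2 * x * c.re)]

lemma en_bdd {Ω : Set (ℝ × ℝ)} (hΩb : Bornology.IsBounded Ω) (ω x₀ y₀ : ℝ) :
    ∃ D : ℝ, ∀ u : ℝ × ℝ → ℂ, ContDiff ℝ 1 u → HasCompactSupport u → tsupport u ⊆ Ω →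
      -D * nrm u ≤ en ω x₀ y₀ u := by
  obtain ⟨ρ, hρ⟩ := hΩb.subset_closedBall (0 : ℝ × ℝ)
  refine ⟨ω ^ 2 / 4 * ((ρ + |x₀|) ^ 2 + (ρ + |y₀|) ^ 2), fun u hu hc hs => ?_⟩
  have hc2 := hu.continuous
  rw [nrm, ← integral_const_mul]
  refine integral_mono ?_ ?_ (fun p => ?_)
  · apply Integrable.const_mul
    exact (by fun_prop : Continuous fun p => ‖u p‖ ^ 2).integrable_of_hasCompactSupport (hcs_nsq hc)
  · exact (continuous_eDens hu ω x₀ y₀).integrable_of_hasCompactSupport (hcs_eDens hc ω x₀ y₀)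
  · by_cases hp : p ∈ tsupport u
    · have h1 := hρ (hs hp)
      rw [mem_closedBall_zero_iff, Prod.norm_def, max_le_iff] at h1
      have h2 := alg_lower ω (p.1 - x₀) (p.2 - y₀) (dX u p) (dY u p) (u p)
      refine le_trans ?_ h2
      have a1 : |p.1 - x₀| ≤ ρ + |x₀| := (abs_sub _ _).trans (by simpa using h1.1)
      have a2 : |p.2 - y₀| ≤ ρ + |y₀| := (abs_sub _ _).trans (by simpa using h1.2)
      have b1 := sq_le_sq' (by linarith [neg_abs_le (p.1 - x₀)]) ((le_abs_self _).trans a1)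
      have b2 := sq_le_sq' (by linarith [neg_abs_le (p.2 - y₀)]) ((le_abs_self _).trans a2)
      apply mul_le_mul_of_nonneg_right _ (by positivity)
      rw [neg_le_neg_iff]
      gcongr
    · simp [zero_eDens ω x₀ y₀ hp, image_eq_zero_of_notMem_tsupport hp]

lemma ground_le_smooth {Ω : Set (ℝ × ℝ)} (hΩb : Bornology.IsBounded Ω) (ω x₀ y₀ : ℝ)
    (u : ℝ × ℝ → ℂ) (hu : ContDiff ℝ (⊤ : ℕ∞) u) (hc : HasCompactSupport u)
    (hs : tsupport u ⊆ Ω) (hn : 0 < nrm u) :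
    groundEnergy Ω ω x₀ y₀ * nrm u ≤ en ω x₀ y₀ u := by
  obtain ⟨D, hD⟩ := en_bdd hΩb ω x₀ y₀
  set k : ℝ := (Real.sqrt (nrm u))⁻¹ with hk
  have hkn : k ^ 2 * nrm u = 1 := by
    rw [hk, inv_pow, Real.sq_sqrt hn.le, inv_mul_cancel₀ hn.ne']
  have hsub : tsupport (fun p => (k : ℂ) * u p) ⊆ tsupport u := tsupport_mul_subset_right
  have hd : ∀ p, fderiv ℝ (fun p => (k : ℂ) * u p) p = (k : ℂ) • fderiv ℝ u p := by
    intro p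
    exact fderiv_const_mul (hu.differentiable (by simp) p) _
  have hmem : k ^ 2 * en ω x₀ y₀ u ∈ {E : ℝ | ∃ u : ℝ × ℝ → ℂ, ContDiff ℝ (⊤ : ℕ∞) u ∧
    HasCompactSupport u ∧ tsupport u ⊆ Ω ∧
    (∫ p, ‖u p‖ ^ 2) = 1 ∧
    E = ∫ p, (‖dX u p‖ ^ 2 + ‖dY u p‖ ^ 2
      + (Complex.I * (ω : ℂ)
          * (((p.1 - x₀ : ℝ) : ℂ) * dY u p - ((p.2 - y₀ : ℝ) : ℂ) * dX u p)
          * (starRingEnd ℂ) (u p)).re)} := by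
    refine ⟨fun p => (k : ℂ) * u p, contDiff_const.mul hu, hc.mul_left, hsub.trans hs, ?_, ?_⟩
    · simp only [norm_mul, mul_pow, integral_const_mul, Complex.norm_real, Real.norm_eq_abs, sq_abs]
      exact hkn
    · rw [en, ← integral_const_mul]
      congr 1
      ext p
      simp only [dX, dY, hd, eDens, smul_apply, smul_eq_mul, norm_mul, mul_pow,
        Complex.norm_real, Real.norm_eq_abs, sq_abs, map_mul, Complex.conj_ofReal]
      generalize (fderiv ℝ u p) (1, 0) = a
      generalize (fderiv ℝ u p) (0, 1) = b
      generalize (starRingEnd ℂ) (u p) = c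
      rw [show Complex.I * (ω : ℂ) * (((p.1 - x₀ : ℝ) : ℂ) * ((k : ℂ) * b)
        - ((p.2 - y₀ : ℝ) : ℂ) * ((k : ℂ) * a)) * ((k : ℂ) * c) = ((k ^ 2 : ℝ) : ℂ) *
        (Complex.I * (ω : ℂ) * (((p.1 - x₀ : ℝ) : ℂ) * b - ((p.2 - y₀ : ℝ) : ℂ) * a) * c) by
          push_cast; ring, Complex.re_ofReal_mul]
      ring
  have hle : groundEnergy Ω ω x₀ y₀ ≤ k ^ 2 * en ω x₀ y₀ u := by
    refine csInf_le ⟨-D, ?_⟩ hmem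
    rintro E ⟨v, hv, hvc, hvs, hv1, rfl⟩
    have := hD v (hv.of_le (by exact_mod_cast le_top)) hvc hvs
    rw [nrm, hv1, mul_one] at this
    exact this
  calc groundEnergy Ω ω x₀ y₀ * nrm u ≤ k ^ 2 * en ω x₀ y₀ u * nrm u := by gcongr
    _ = (k ^ 2 * nrm u) * en ω x₀ y₀ u := by ring
    _ = en ω x₀ y₀ u := by rw [hkn, one_mul]
end

section
open MeasureTheory

lemma mollify_one {u : ℝ × ℝ → ℂ} (hu : ContDiff ℝ 1 u) (hc : HasCompactSupport u)
    {δ : ℝ} (hδ : 0 < δ) {ε : ℝ} (hε : 0 < ε) :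
    ∃ v : ℝ × ℝ → ℂ, ContDiff ℝ (⊤ : ℕ∞) v ∧ tsupport v ⊆ Metric.cthickening δ (tsupport u) ∧
      ∀ p, dist (v p) (u p) ≤ ε ∧ dist (dX v p) (dX u p) ≤ ε ∧ dist (dY v p) (dY u p) ≤ ε := by
  obtain ⟨d1, hd1, h1⟩ := Metric.uniformContinuous_iff.1
    (hc.uniformContinuous_of_continuous hu.continuous) ε hε
  obtain ⟨d2, hd2, h2⟩ := Metric.uniformContinuous_iff.1
    ((hcs_dX hc).uniformContinuous_of_continuous (continuous_dX hu)) ε hε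
  obtain ⟨d3, hd3, h3⟩ := Metric.uniformContinuous_iff.1
    ((hcs_dY hc).uniformContinuous_of_continuous (continuous_dY hu)) ε hε
  set d := min (min d1 d2) (min d3 δ) with hd
  have hdpos : 0 < d := by positivity
  let φ : ContDiffBump (0 : ℝ × ℝ) := ⟨d / 2, d, by positivity, by linarith⟩
  have hφ : φ.rOut = d := rfl
  set ψ := φ.normed (volume : Measure (ℝ × ℝ)) with hψ
  have hψs : ContDiff ℝ (⊤ : ℕ∞) ψ := φ.contDiff_normed
  have hψc : HasCompactSupport ψ := φ.hasCompactSupport_normed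
  have hψl : LocallyIntegrable ψ volume := hψs.continuous.locallyIntegrable
  have hul : LocallyIntegrable u volume := hu.continuous.locallyIntegrable
  set v := convolution ψ u (ContinuousLinearMap.lsmul ℝ ℝ) volume with hv
  have hder : ∀ p w, fderiv ℝ v p w =
      convolution ψ (fun a => fderiv ℝ u a w) (ContinuousLinearMap.lsmul ℝ ℝ) volume p := by
    intro p w
    rw [(hc.hasFDerivAt_convolution_right (ContinuousLinearMap.lsmul ℝ ℝ) hψl hu p).fderiv]
    exact convolution_precompR_apply _ hψl (hc.fderiv ℝ) (hu.continuous_fderiv one_ne_zero) p w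
  refine ⟨v, hψc.contDiff_convolution_left _ hψs hul, ?_, fun p => ⟨?_, ?_, ?_⟩⟩
  · apply closure_minimal _ Metric.isClosed_cthickening
    refine (support_convolution_subset _).trans ?_
    rintro p ⟨a, ha, b, hb, rfl⟩
    rw [φ.support_normed_eq, hφ] at ha
    refine Metric.mem_cthickening_of_dist_le _ b _ _ (subset_closure hb) ?_
    have : dist (a + b) b = ‖a‖ := by simp [dist_eq_norm]
    simp only [this]
    rw [mem_ball_zero_iff] at ha
    exact ha.le.trans (by simp [hd])
  · refine ContDiffBump.dist_normed_convolution_le hu.continuous.aestronglyMeasurable ?_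
    intro x hx
    exact (h1 (lt_of_lt_of_le hx (by simp [hφ, hd]))).le
  · rw [dX, hder]
    refine ContDiffBump.dist_normed_convolution_le (g := dX u)
      (continuous_dX hu).aestronglyMeasurable ?_
    intro x hx
    exact (h2 (lt_of_lt_of_le hx (by simp [hφ, hd]))).le
  · rw [dY, hder]
    refine ContDiffBump.dist_normed_convolution_le (g := dY u)
      (continuous_dY hu).aestronglyMeasurable ?_
    intro x hx
    exact (h3 (lt_of_lt_of_le hx (by simp [hφ, hd]))).le

lemma eDens_bound {ω x₀ y₀ : ℝ} {v : ℝ × ℝ → ℂ} {p : ℝ × ℝ} {C D : ℝ} (h1 : ‖v p‖ ≤ C)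
    (h2 : ‖dX v p‖ ≤ C) (h3 : ‖dY v p‖ ≤ C) (h4 : |p.1 - x₀| ≤ D) (h5 : |p.2 - y₀| ≤ D) :
    ‖eDens ω x₀ y₀ v p‖ ≤ C ^ 2 + C ^ 2 + |ω| * (D * C + D * C) * C := by
  unfold eDens
  have hC : 0 ≤ C := (norm_nonneg _).trans h1
  have hD : 0 ≤ D := (abs_nonneg _).trans h4
  refine (norm_add_le _ _).trans ?_
  gcongr
  · refine (norm_add_le _ _).trans ?_
    rw [norm_pow, norm_pow, norm_norm, norm_norm]
    gcongr
  · refine (Complex.abs_re_le_norm _).trans ?_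
    rw [norm_mul, norm_mul, norm_mul, Complex.norm_I, one_mul, Complex.norm_real, RCLike.norm_conj,
      Real.norm_eq_abs]
    gcongr
    refine (norm_sub_le _ _).trans ?_
    rw [norm_mul, norm_mul, Complex.norm_real, Complex.norm_real, Real.norm_eq_abs,
      Real.norm_eq_abs]
    gcongr

lemma ground_le {Ω : Set (ℝ × ℝ)} (hΩo : IsOpen Ω) (hΩb : Bornology.IsBounded Ω) (ω x₀ y₀ : ℝ)
    (u : ℝ × ℝ → ℂ) (hu : ContDiff ℝ 1 u) (hc : HasCompactSupport u)
    (hs : tsupport u ⊆ Ω) (hn : 0 < nrm u) :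
    groundEnergy Ω ω x₀ y₀ * nrm u ≤ en ω x₀ y₀ u := by
  obtain ⟨δ, hδ, hδs⟩ := hc.isCompact.exists_cthickening_subset_open hΩo hs
  have hK : IsCompact (Metric.cthickening δ (tsupport u)) := hc.isCompact.cthickening
  set K := Metric.cthickening δ (tsupport u) with hKdef
  have hex := fun n : ℕ => mollify_one hu hc hδ (ε := 1 / ((n : ℝ) + 1)) (by positivity)
  choose v hv1 hv2 hv3 using hex
  have hvc : ∀ n, HasCompactSupport (v n) := fun n =>
    HasCompactSupport.of_support_subset_isCompact hK (subset_closure.trans (hv2 n))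
  have hv1' : ∀ n, ContDiff ℝ 1 (v n) := fun n => (hv1 n).of_le (by exact_mod_cast le_top)
  obtain ⟨C1, hC1⟩ := hc.exists_bound_of_continuous hu.continuous
  obtain ⟨C2, hC2⟩ := (hcs_dX hc).exists_bound_of_continuous (continuous_dX hu)
  obtain ⟨C3, hC3⟩ := (hcs_dY hc).exists_bound_of_continuous (continuous_dY hu)
  set C := max C1 (max C2 C3) + 1 with hCdef
  have hle1 : ∀ n : ℕ, 1 / ((n : ℝ) + 1) ≤ 1 := fun n => by
    rw [div_le_one (by positivity)]; linarith [n.cast_nonneg (α := ℝ)]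
  have hb : ∀ {a b : ℂ} {n : ℕ}, dist a b ≤ 1 / ((n : ℝ) + 1) → ‖b‖ ≤ max C1 (max C2 C3) →
      ‖a‖ ≤ C := by
    intro a b n h1 h2
    have := norm_le_norm_add_norm_sub' a b
    rw [← dist_eq_norm] at this
    linarith [hle1 n]
  have hbv : ∀ n p, ‖v n p‖ ≤ C := fun n p => hb (hv3 n p).1 ((hC1 p).trans (by simp))
  have hbx : ∀ n p, ‖dX (v n) p‖ ≤ C := fun n p => hb (hv3 n p).2.1 ((hC2 p).trans (by simp))
  have hby : ∀ n p, ‖dY (v n) p‖ ≤ C := fun n p => hb (hv3 n p).2.2 ((hC3 p).trans (by simp))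
  have hlim : ∀ {a : ℕ → ℂ} {b : ℂ}, (∀ n : ℕ, dist (a n) b ≤ 1 / ((n : ℝ) + 1)) →
      Filter.Tendsto a Filter.atTop (nhds b) := by
    intro a b h
    rw [tendsto_iff_dist_tendsto_zero]
    exact squeeze_zero (fun _ => dist_nonneg) h tendsto_one_div_add_atTop_nhds_zero_nat
  have hlv : ∀ p, Filter.Tendsto (fun n => v n p) Filter.atTop (nhds (u p)) :=
    fun p => hlim fun n => (hv3 n p).1
  have hlx : ∀ p, Filter.Tendsto (fun n => dX (v n) p) Filter.atTop (nhds (dX u p)) :=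
    fun p => hlim fun n => (hv3 n p).2.1
  have hly : ∀ p, Filter.Tendsto (fun n => dY (v n) p) Filter.atTop (nhds (dY u p)) :=
    fun p => hlim fun n => (hv3 n p).2.2
  obtain ⟨ρ, hρ⟩ := hK.isBounded.subset_closedBall (0 : ℝ × ℝ)
  set D := max (ρ + |x₀|) (ρ + |y₀|) with hD
  have hKint : ∀ c : ℝ, Integrable (K.indicator (fun _ => c)) volume := fun c =>
    (integrable_indicator_iff hK.measurableSet).2 (integrableOn_const hK.measure_lt_top.ne)
  have hN : Filter.Tendsto (fun n => nrm (v n)) Filter.atTop (nhds (nrm u)) := by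
    refine tendsto_integral_of_dominated_convergence (K.indicator (fun _ => C ^ 2)) ?_ (hKint _) ?_
      ?_
    · intro n
      have := (hv1' n).continuous
      exact (by fun_prop : Continuous fun p => ‖v n p‖ ^ 2).aestronglyMeasurable
    · intro n
      refine Filter.Eventually.of_forall fun p => ?_
      by_cases hp : p ∈ K
      · rw [Set.indicator_of_mem hp, norm_pow, norm_norm]
        exact pow_le_pow_left₀ (norm_nonneg _) (hbv n p) 2
      · rw [Set.indicator_of_notMem hp, image_eq_zero_of_notMem_tsupport (fun h => hp (hv2 n h))]
        simp
    · exact Filter.Eventually.of_forall fun p => ((hlv p).norm).pow 2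
  have hE : Filter.Tendsto (fun n => en ω x₀ y₀ (v n)) Filter.atTop (nhds (en ω x₀ y₀ u)) := by
    refine tendsto_integral_of_dominated_convergence
      (K.indicator (fun _ => C ^ 2 + C ^ 2 + |ω| * (D * C + D * C) * C)) ?_ (hKint _) ?_ ?_
    · intro n
      exact (continuous_eDens (hv1' n) ω x₀ y₀).aestronglyMeasurable
    · intro n
      refine Filter.Eventually.of_forall fun p => ?_
      by_cases hp : p ∈ K
      · rw [Set.indicator_of_mem hp]
        have h1 := hρ hp
        rw [mem_closedBall_zero_iff, Prod.norm_def, max_le_iff] at h1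
        have a1 : |p.1 - x₀| ≤ ρ + |x₀| := (abs_sub _ _).trans (by simpa using h1.1)
        have a2 : |p.2 - y₀| ≤ ρ + |y₀| := (abs_sub _ _).trans (by simpa using h1.2)
        exact eDens_bound (hbv n p) (hbx n p) (hby n p) (a1.trans (le_max_left _ _))
          (a2.trans (le_max_right _ _))
      · rw [Set.indicator_of_notMem hp, zero_eDens _ _ _ (fun h => hp (hv2 n h))]
        simp
    · refine Filter.Eventually.of_forall fun p => ?_
      refine ((((hlx p).norm).pow 2).add (((hly p).norm).pow 2)).add ?_
      refine (Complex.continuous_re.tendsto _).comp ?_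
      refine (Filter.Tendsto.mul ?_ ((Complex.continuous_conj.tendsto _).comp (hlv p)))
      exact ((((hly p).const_mul _).sub ((hlx p).const_mul _)).const_mul _)
  refine le_of_tendsto_of_tendsto (hN.const_mul _) hE ?_
  filter_upwards [hN.eventually (lt_mem_nhds hn)] with n hn
  exact ground_le_smooth hΩb ω x₀ y₀ (v n) (hv1 n) (hvc n) ((hv2 n).trans hδs) hn
end

section
open MeasureTheory

noncomputable def pol (x₀ y₀ r φ : ℝ) : ℝ × ℝ := (x₀ + r * Real.cos φ, y₀ + r * Real.sin φ)

noncomputable def dR (x₀ y₀ : ℝ) (u : ℝ × ℝ → ℂ) (r φ : ℝ) : ℂ :=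
  (Real.cos φ : ℂ) * dX u (pol x₀ y₀ r φ) + (Real.sin φ : ℂ) * dY u (pol x₀ y₀ r φ)

noncomputable def dV (x₀ y₀ : ℝ) (u : ℝ × ℝ → ℂ) (r φ : ℝ) : ℂ :=
  -(Real.sin φ : ℂ) * dX u (pol x₀ y₀ r φ) + (Real.cos φ : ℂ) * dY u (pol x₀ y₀ r φ)

lemma fderiv_comb (u : ℝ × ℝ → ℂ) (p : ℝ × ℝ) (a b : ℝ) :
    fderiv ℝ u p (a, b) = (a : ℂ) * dX u p + (b : ℂ) * dY u p := by
  have : ((a, b) : ℝ × ℝ) = a • (1, 0) + b • (0, 1) := by simp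
  rw [this, map_add, map_smul, map_smul]
  simp [dX, dY]

lemma hasDerivAt_pol_r (x₀ y₀ : ℝ) {u : ℝ × ℝ → ℂ} {r φ : ℝ}
    (hu : DifferentiableAt ℝ u (pol x₀ y₀ r φ)) :
    HasDerivAt (fun r => u (pol x₀ y₀ r φ)) (dR x₀ y₀ u r φ) r := by
  have h1 : HasDerivAt (fun r => pol x₀ y₀ r φ) (Real.cos φ, Real.sin φ) r := by
    unfold pol
    apply HasDerivAt.prodMk
    · simpa using ((hasDerivAt_id r).mul_const (Real.cos φ)).const_add x₀
    · simpa using ((hasDerivAt_id r).mul_const (Real.sin φ)).const_add y₀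
  have h2 := hu.hasFDerivAt.comp_hasDerivAt r h1
  rw [fderiv_comb] at h2
  exact h2

lemma hasDerivAt_pol_phi (x₀ y₀ : ℝ) {u : ℝ × ℝ → ℂ} {r φ : ℝ}
    (hu : DifferentiableAt ℝ u (pol x₀ y₀ r φ)) :
    HasDerivAt (fun φ => u (pol x₀ y₀ r φ)) (r * dV x₀ y₀ u r φ) φ := by
  have h1 : HasDerivAt (fun φ => pol x₀ y₀ r φ) (r * -Real.sin φ, r * Real.cos φ) φ := by
    unfold pol
    apply HasDerivAt.prodMk
    · exact ((Real.hasDerivAt_cos φ).const_mul r).const_add x₀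
    · exact ((Real.hasDerivAt_sin φ).const_mul r).const_add y₀
  have h2 := hu.hasFDerivAt.comp_hasDerivAt φ h1
  rw [fderiv_comb] at h2
  refine h2.congr_deriv ?_
  simp only [dV]
  push_cast
  ring

lemma eDens_pol (ω x₀ y₀ : ℝ) (u : ℝ × ℝ → ℂ) (r φ : ℝ) :
    eDens ω x₀ y₀ u (pol x₀ y₀ r φ) = ‖dR x₀ y₀ u r φ‖ ^ 2 + ‖dV x₀ y₀ u r φ‖ ^ 2
      + (Complex.I * (ω : ℂ) * ((r : ℂ) * dV x₀ y₀ u r φ)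
        * (starRingEnd ℂ) (u (pol x₀ y₀ r φ))).re := by
  unfold eDens dR dV
  have e1 : (pol x₀ y₀ r φ).1 - x₀ = r * Real.cos φ := by simp [pol]
  have e2 : (pol x₀ y₀ r φ).2 - y₀ = r * Real.sin φ := by simp [pol]
  rw [e1, e2]
  generalize dX u (pol x₀ y₀ r φ) = a
  generalize dY u (pol x₀ y₀ r φ) = b
  generalize u (pol x₀ y₀ r φ) = c
  congr 1
  · have h := Real.sin_sq_add_cos_sq φ
    simp only [← Complex.normSq_eq_norm_sq, Complex.normSq_apply, Complex.add_re, Complex.add_im,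
      Complex.mul_re, Complex.mul_im, Complex.ofReal_re, Complex.ofReal_im, Complex.neg_re,
      Complex.neg_im]
    linear_combination (-(a.re ^ 2 + a.im ^ 2 + b.re ^ 2 + b.im ^ 2)) * h
  · congr 1
    push_cast
    ring

lemma continuous_pol (x₀ y₀ : ℝ) : Continuous (fun q : ℝ × ℝ => pol x₀ y₀ q.1 q.2) := by
  unfold pol; fun_prop

lemma continuous_dR (x₀ y₀ : ℝ) {u : ℝ × ℝ → ℂ} (hu : ContDiff ℝ 1 u) :
    Continuous (fun q : ℝ × ℝ => dR x₀ y₀ u q.1 q.2) := by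
  have h1 := (continuous_dX hu).comp (continuous_pol x₀ y₀)
  have h2 := (continuous_dY hu).comp (continuous_pol x₀ y₀)
  simp only [Function.comp_def] at h1 h2
  unfold dR
  fun_prop

lemma continuous_dV (x₀ y₀ : ℝ) {u : ℝ × ℝ → ℂ} (hu : ContDiff ℝ 1 u) :
    Continuous (fun q : ℝ × ℝ => dV x₀ y₀ u q.1 q.2) := by
  have h1 := (continuous_dX hu).comp (continuous_pol x₀ y₀)
  have h2 := (continuous_dY hu).comp (continuous_pol x₀ y₀)
  simp only [Function.comp_def] at h1 h2
  unfold dV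
  fun_prop

lemma polar_prod (x₀ y₀ : ℝ) (F : ℝ × ℝ → ℝ) {a : ℝ}
    (hF : ∀ r φ, a < r → F (pol x₀ y₀ r φ) = 0) :
    ∫ p, F p = ∫ q in Set.Ioc 0 a ×ˢ Set.Ioc (-Real.pi) Real.pi,
      q.1 * F (pol x₀ y₀ q.1 q.2) := by
  have h1 : ∫ p, F p = ∫ p, F (p + (x₀, y₀)) := (integral_add_right_eq_self F (x₀, y₀)).symm
  rw [h1, ← integral_comp_polarCoord_symm]
  have h2 : ∀ q : ℝ × ℝ, q.1 • F (polarCoord.symm q + (x₀, y₀)) =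
      q.1 * F (pol x₀ y₀ q.1 q.2) := by
    intro q
    simp [polarCoord, pol, add_comm]
  simp only [h2]
  have e1 : (Set.Ioc 0 a ×ˢ Set.Ioc (-Real.pi) Real.pi : Set (ℝ × ℝ)) =ᵐ[volume]
      (Set.Ioc 0 a ×ˢ Set.Ioo (-Real.pi) Real.pi : Set (ℝ × ℝ)) := by
    rw [Measure.volume_eq_prod]
    exact Measure.set_prod_ae_eq (ae_eq_refl _) Ioo_ae_eq_Ioc.symm
  rw [setIntegral_congr_set e1]
  apply setIntegral_eq_of_subset_of_forall_sdiff_eq_zero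
  · exact polarCoord.open_target.measurableSet
  · rw [polarCoord_target]
    exact Set.prod_mono Set.Ioc_subset_Ioi_self le_rfl
  · rintro ⟨r, φ⟩ ⟨hq1, hq2⟩
    rw [polarCoord_target] at hq1
    have : a < r := by
      by_contra h
      exact hq2 ⟨⟨hq1.1, not_lt.1 h⟩, hq1.2⟩
    simp [hF r φ this]

lemma polar_int_phi (x₀ y₀ : ℝ) (F : ℝ × ℝ → ℝ) {a : ℝ} (ha : 0 ≤ a)
    (hF : ∀ r φ, a < r → F (pol x₀ y₀ r φ) = 0)
    (hIntg : IntegrableOn (fun q : ℝ × ℝ => q.1 * F (pol x₀ y₀ q.1 q.2))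
      (Set.Ioc 0 a ×ˢ Set.Ioc (-Real.pi) Real.pi)) :
    ∫ p, F p = ∫ φ in (-Real.pi)..Real.pi, ∫ r in (0)..a, r * F (pol x₀ y₀ r φ) := by
  rw [polar_prod x₀ y₀ F hF, intervalIntegral.integral_of_le (by linarith [Real.pi_pos])]
  simp only [intervalIntegral.integral_of_le ha]
  rw [Measure.volume_eq_prod] at hIntg ⊢
  rw [IntegrableOn, ← Measure.prod_restrict] at hIntg
  rw [← Measure.prod_restrict, integral_prod_symm _ hIntg]

lemma polar_int_r (x₀ y₀ : ℝ) (F : ℝ × ℝ → ℝ) {a : ℝ} (ha : 0 ≤ a)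
    (hF : ∀ r φ, a < r → F (pol x₀ y₀ r φ) = 0)
    (hIntg : IntegrableOn (fun q : ℝ × ℝ => q.1 * F (pol x₀ y₀ q.1 q.2))
      (Set.Ioc 0 a ×ˢ Set.Ioc (-Real.pi) Real.pi)) :
    ∫ p, F p = ∫ r in (0)..a, r * ∫ φ in (-Real.pi)..Real.pi, F (pol x₀ y₀ r φ) := by
  rw [polar_prod x₀ y₀ F hF, intervalIntegral.integral_of_le ha]
  simp only [intervalIntegral.integral_of_le (by linarith [Real.pi_pos] : -Real.pi ≤ Real.pi)]
  rw [Measure.volume_eq_prod] at hIntg ⊢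
  rw [setIntegral_prod _ hIntg]
  simp only [integral_const_mul]

lemma polar_integrable (x₀ y₀ : ℝ) {F : ℝ × ℝ → ℝ} (hF : Continuous F) (a : ℝ) :
    IntegrableOn (fun q : ℝ × ℝ => q.1 * F (pol x₀ y₀ q.1 q.2))
      (Set.Ioc 0 a ×ˢ Set.Ioc (-Real.pi) Real.pi) := by
  have hc : Continuous (fun q : ℝ × ℝ => q.1 * F (pol x₀ y₀ q.1 q.2)) :=
    continuous_fst.mul (hF.comp (continuous_pol x₀ y₀))
  refine (hc.continuousOn.integrableOn_compact (K := Set.Icc 0 a ×ˢ Set.Icc (-Real.pi) Real.pi)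
    (isCompact_Icc.prod isCompact_Icc)).mono_set ?_
  exact Set.prod_mono Set.Ioc_subset_Icc_self Set.Ioc_subset_Icc_self
end

section
open MeasureTheory

structure BF (f : ℝ → ℝ) (m : ℕ) (lam R₀ : ℝ) : Prop where
  smooth : ContDiff ℝ 2 f
  pos : ∀ r, 0 < r → r < R₀ → 0 < f r
  zero : f R₀ = 0
  ode : ∀ r, 0 < r → r ^ 2 * deriv (deriv f) r + r * deriv f r
    + (lam * r ^ 2 - (m : ℝ) ^ 2) * f r = 0

lemma exists_BF {J : ℝ → ℝ} {m : ℕ} {j R₀ : ℝ} (hR₀ : 0 < R₀) (hJsm : ContDiff ℝ (⊤ : ℕ∞) J)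
    (hJode : ∀ x : ℝ, 0 < x →
      x ^ 2 * deriv (deriv J) x + x * deriv J x + (x ^ 2 - (m : ℝ) ^ 2) * J x = 0)
    (hj : 0 < j) (hjz : J j = 0) (hjf : ∀ x : ℝ, 0 < x → x < j → J x ≠ 0) :
    ∃ f, BF f m (j ^ 2 / R₀ ^ 2) R₀ := by
  have hsign : ∃ σ : ℝ, ∀ x, 0 < x → x < j → 0 < σ * J x := by
    have hpre : IsPreconnected (J '' Set.Ioo 0 j) :=
      isPreconnected_Ioo.image _ hJsm.continuous.continuousOn
    have h0 : (0 : ℝ) ∉ J '' Set.Ioo 0 j := by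
      rintro ⟨x, hx, hx0⟩
      exact hjf x hx.1 hx.2 hx0
    have hmid : J (j / 2) ∈ J '' Set.Ioo 0 j := ⟨j / 2, ⟨by linarith, by linarith⟩, rfl⟩
    have hord := hpre.ordConnected
    rcases lt_or_gt_of_ne (hjf (j / 2) (by linarith) (by linarith)) with h | h
    · refine ⟨-1, fun x h1 h2 => ?_⟩
      by_contra hn
      exact h0 (hord.out hmid ⟨x, ⟨h1, h2⟩, rfl⟩ ⟨h.le, by linarith⟩)
    · refine ⟨1, fun x h1 h2 => ?_⟩
      by_contra hn
      exact h0 (hord.out ⟨x, ⟨h1, h2⟩, rfl⟩ hmid ⟨by linarith, h.le⟩)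
  obtain ⟨σ, hσ⟩ := hsign
  set k := j / R₀ with hk
  have hkp : 0 < k := by positivity
  have hsm2 : ContDiff ℝ 2 J := contDiff_infty.1 hJsm 2
  have d1 : deriv (fun r => σ * J (k * r)) = fun r => σ * (k * deriv J (k * r)) := by
    ext r
    rw [deriv_const_mul_field, deriv_comp_mul_left]
    simp
  have d2 : deriv (fun r => σ * (k * deriv J (k * r))) =
      fun r => σ * (k * (k * deriv (deriv J) (k * r))) := by
    ext r
    rw [deriv_const_mul_field, deriv_const_mul_field, deriv_comp_mul_left]
    simp
  refine ⟨fun r => σ * J (k * r), ?_, ?_, ?_, ?_⟩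
  · exact contDiff_const.mul (hsm2.comp (contDiff_const.mul contDiff_id))
  · intro r h1 h2
    apply hσ _ (by positivity)
    rw [hk, div_mul_eq_mul_div, div_lt_iff₀ hR₀]
    gcongr
  · simp [hk, div_mul_cancel₀ _ hR₀.ne', hjz]
  · intro r hr
    rw [d1, d2]
    have := hJode (k * r) (by positivity)
    have hkk : j ^ 2 / R₀ ^ 2 = k ^ 2 := by rw [hk, div_pow]
    simp only [hkk]
    linear_combination σ * this

namespace BF
variable {f : ℝ → ℝ} {m : ℕ} {lam R₀ : ℝ}

lemma d1 (h : BF f m lam R₀) (r : ℝ) : HasDerivAt f (deriv f r) r :=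
  (h.smooth.differentiable (by norm_num) r).hasDerivAt

lemma smooth1 (h : BF f m lam R₀) : ContDiff ℝ 1 (deriv f) := by
  have := h.smooth
  rw [show (2 : WithTop ℕ∞) = 1 + 1 by norm_num, contDiff_succ_iff_deriv] at this
  exact this.2.2

lemma d2 (h : BF f m lam R₀) (r : ℝ) : HasDerivAt (deriv f) (deriv (deriv f) r) r :=
  (h.smooth1.differentiable (by norm_num) r).hasDerivAt

lemma c0 (h : BF f m lam R₀) : Continuous f := h.smooth.continuous
lemma c1 (h : BF f m lam R₀) : Continuous (deriv f) := h.smooth1.continuous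
lemma c2 (h : BF f m lam R₀) : Continuous (deriv (deriv f)) :=
  h.smooth1.continuous_deriv (by norm_num)

lemma f_zero (h : BF f m lam R₀) (hm : m ≠ 0) : f 0 = 0 := by
  have hc : Continuous fun r => r ^ 2 * deriv (deriv f) r + r * deriv f r
    + (lam * r ^ 2 - (m : ℝ) ^ 2) * f r := by
    have := h.c0; have := h.c1; have := h.c2
    fun_prop
  have h1 := (hc.tendsto 0).mono_left (nhdsWithin_le_nhds (s := Set.Ioi 0))
  have h2 : Filter.Tendsto (fun r => r ^ 2 * deriv (deriv f) r + r * deriv f r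
    + (lam * r ^ 2 - (m : ℝ) ^ 2) * f r) (nhdsWithin 0 (Set.Ioi 0)) (nhds 0) := by
    refine Filter.Tendsto.congr' ?_ tendsto_const_nhds
    filter_upwards [self_mem_nhdsWithin] with r hr
    exact (h.ode r hr).symm
  have h3 := tendsto_nhds_unique h1 h2
  have hm' : (m : ℝ) ≠ 0 := by exact_mod_cast hm
  simpa [hm'] using h3

lemma rderiv_le (h : BF f m lam R₀) (hlam : 0 ≤ lam) {r : ℝ} (hr : 0 < r) (hr2 : r < R₀) :
    r * deriv f r ≤ m * f r := by
  have hW : ∀ x, HasDerivAt (fun x => x ^ m * (x * deriv f x - m * f x))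
      ((m * x ^ (m - 1)) * (x * deriv f x - m * f x) +
        x ^ m * ((1 * deriv f x + x * deriv (deriv f) x) - m * deriv f x)) x := by
    intro x
    exact (hasDerivAt_pow m x).mul (((hasDerivAt_id x).mul (h.d2 x)).sub ((h.d1 x).const_mul _))
  have hanti : AntitoneOn (fun x => x ^ m * (x * deriv f x - m * f x)) (Set.Icc 0 r) := by
    apply antitoneOn_of_deriv_nonpos (convex_Icc 0 r)
    · exact fun x _ => (hW x).continuousAt.continuousWithinAt
    · exact fun x _ => (hW x).differentiableAt.differentiableWithinAt
    · intro x hx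
      rw [interior_Icc] at hx
      rw [(hW x).deriv]
      have hpow : (m : ℝ) * x ^ (m - 1) * x = m * x ^ m := by
        rcases Nat.eq_zero_or_pos m with h0 | h0
        · simp [h0]
        · rw [mul_assoc, ← pow_succ, Nat.sub_add_cancel h0]
      have hode := h.ode x hx.1
      have hfx := h.pos x hx.1 (hx.2.trans hr2)
      have key : x * ((m * x ^ (m - 1)) * (x * deriv f x - m * f x) +
        x ^ m * ((1 * deriv f x + x * deriv (deriv f) x) - m * deriv f x))
        = - (x ^ m * (lam * x ^ 2 * f x)) := by
        linear_combination (x * deriv f x - m * f x) * hpow + x ^ m * hode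
      have hnp : x * ((m * x ^ (m - 1)) * (x * deriv f x - m * f x) +
        x ^ m * ((1 * deriv f x + x * deriv (deriv f) x) - m * deriv f x)) ≤ 0 := by
        rw [key]
        have := hx.1
        have : 0 ≤ x ^ m * (lam * x ^ 2 * f x) := by positivity
        linarith
      exact nonpos_of_mul_nonpos_right hnp hx.1
  have h1 := hanti (Set.left_mem_Icc.2 hr.le) (Set.right_mem_Icc.2 hr.le) hr.le
  have h0 : (0 : ℝ) ^ m * (0 * deriv f 0 - m * f 0) = 0 := by
    rcases Nat.eq_zero_or_pos m with h0 | h0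
    · simp [h0]
    · simp [h0.ne']
  simp only [h0] at h1
  have := nonpos_of_mul_nonpos_right h1 (by positivity : 0 < r ^ m)
  linarith

/-- energy identity -/
lemma energy (h : BF f m lam R₀) (hR₀ : 0 < R₀) :
    (0 < ∫ r in (0)..R₀, r * f r ^ 2) ∧
    (∫ r in (0)..R₀, r * deriv f r ^ 2) + (∫ r in (0)..R₀, (m : ℝ) ^ 2 * (f r ^ 2 / r))
      = lam * ∫ r in (0)..R₀, r * f r ^ 2 ∧
    (m : ℝ) ^ 2 / R₀ ^ 2 * (∫ r in (0)..R₀, r * f r ^ 2)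
      ≤ ∫ r in (0)..R₀, (m : ℝ) ^ 2 * (f r ^ 2 / r) := by
  have c0 := h.c0
  have c1 := h.c1
  have c2 := h.c2
  have hpos : 0 < ∫ r in (0)..R₀, r * f r ^ 2 := by
    apply intervalIntegral.intervalIntegral_pos_of_pos_on
    · exact (by fun_prop : Continuous fun r => r * f r ^ 2).intervalIntegrable _ _
    · intro r hr
      have := h.pos r hr.1 hr.2
      have := hr.1
      positivity
    · exact hR₀
  have hae : ∀ᵐ r, r ∈ Set.uIoc 0 R₀ → (m : ℝ) ^ 2 * (f r ^ 2 / r) =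
      deriv f r * f r + r * f r * deriv (deriv f) r + lam * (r * f r ^ 2) := by
    refine Filter.Eventually.of_forall fun r hr => ?_
    rw [Set.uIoc_of_le hR₀.le] at hr
    have hr0 : r ≠ 0 := hr.1.ne'
    have := h.ode r hr.1
    field_simp
    linear_combination (- f r) * this
  have hBc : Continuous fun r => deriv f r * f r + r * f r * deriv (deriv f) r
      + lam * (r * f r ^ 2) := by fun_prop
  have hBint : IntervalIntegrable (fun r => (m : ℝ) ^ 2 * (f r ^ 2 / r)) volume 0 R₀ := by
    refine (hBc.intervalIntegrable 0 R₀).congr_ae ?_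
    rw [Filter.EventuallyEq, ae_restrict_iff' measurableSet_uIoc]
    filter_upwards [hae] with r hr hr2
    exact (hr hr2).symm
  refine ⟨hpos, ?_, ?_⟩
  · rw [intervalIntegral.integral_congr_ae hae]
    have hA : IntervalIntegrable (fun r => r * deriv f r ^ 2) volume 0 R₀ :=
      (by fun_prop : Continuous fun r => r * deriv f r ^ 2).intervalIntegrable _ _
    have hC : IntervalIntegrable (fun r => lam * (r * f r ^ 2)) volume 0 R₀ :=
      (by fun_prop : Continuous fun r => lam * (r * f r ^ 2)).intervalIntegrable _ _
    rw [← sub_eq_zero, ← intervalIntegral.integral_const_mul,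
      ← intervalIntegral.integral_add hA (hBc.intervalIntegrable _ _),
      ← intervalIntegral.integral_sub (hA.add (hBc.intervalIntegrable _ _)) hC]
    have hd : ∀ r ∈ Set.uIcc 0 R₀, HasDerivAt (fun r => r * deriv f r * f r)
      (r * deriv f r ^ 2 + (deriv f r * f r + r * f r * deriv (deriv f) r + lam * (r * f r ^ 2))
        - lam * (r * f r ^ 2)) r := by
      intro r _
      refine ((((hasDerivAt_id r).mul (h.d2 r)).mul (h.d1 r))).congr_deriv ?_
      simp only [id]
      simp only [Pi.mul_apply, id]
      ring
    rw [intervalIntegral.integral_eq_sub_of_hasDerivAt hd]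
    · simp [h.zero]
    · exact (hA.add (hBc.intervalIntegrable _ _)).sub hC
  · rw [← intervalIntegral.integral_const_mul]
    apply intervalIntegral.integral_mono_on_of_le_Ioo hR₀.le
    · exact (by fun_prop : Continuous fun r => (m : ℝ) ^ 2 / R₀ ^ 2 *
        (r * f r ^ 2)).intervalIntegrable _ _
    · exact hBint
    · intro r hr
      have hr1 := hr.1
      have hr2 := hr.2
      rw [div_mul_eq_mul_div, mul_div_assoc]
      gcongr (m : ℝ) ^ 2 * ?_
      rw [div_le_div_iff₀ (by positivity) hr1]
      have : r * f r ^ 2 * r = f r ^ 2 * r ^ 2 := by ring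
      rw [this]
      gcongr

lemma picone (h : BF f m lam R₀) (hlam : 0 ≤ lam) {a : ℝ} (ha : 0 < a) (haR : a < R₀)
    {c c' : ℝ → ℂ} (hc : ∀ r, HasDerivAt c (c' r) r) (hca : c a = 0)
    (hc0 : m ≠ 0 → c 0 = 0) {D : ℝ → ℝ} (hD : Continuous D)
    (hDeq : ∀ r, 0 < r → D r = r * ‖c' r‖ ^ 2 + (m : ℝ) ^ 2 / r * ‖c r‖ ^ 2 - lam * r * ‖c r‖ ^ 2) :
    0 ≤ ∫ r in (0)..a, D r := by
  have hP : ∀ r, 0 < r → r < R₀ → HasDerivAt (fun r => ‖c r‖ ^ 2 * (r * deriv f r / f r))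
      (2 * inner ℝ (c r) (c' r) * (r * deriv f r / f r) + ‖c r‖ ^ 2 *
        (((1 * deriv f r + r * deriv (deriv f) r) * f r - r * deriv f r * deriv f r) / f r ^ 2)) r
        := by
    intro r hr hr2
    exact (hc r).norm_sq.mul ((((hasDerivAt_id r).mul (h.d2 r))).div (h.d1 r) (h.pos r hr hr2).ne')
  have hineq : ∀ ε, 0 < ε → ε < a → -(m * ‖c ε‖ ^ 2) ≤ ∫ r in ε..a, D r := by
    intro ε hε hεa
    have h1 : ‖c a‖ ^ 2 * (a * deriv f a / f a) - ‖c ε‖ ^ 2 * (ε * deriv f ε / f ε)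
        ≤ ∫ r in ε..a, D r := by
      apply intervalIntegral.sub_le_integral_of_hasDeriv_right_of_le
        (g := fun r => ‖c r‖ ^ 2 * (r * deriv f r / f r)) hεa.le
      · intro r hr
        exact (hP r (hε.trans_le hr.1) (hr.2.trans_lt haR)).continuousAt.continuousWithinAt
      · intro r hr
        exact (hP r (hε.trans hr.1) (hr.2.trans haR)).hasDerivWithinAt
      · exact hD.continuousOn.integrableOn_Icc
      · intro r hr
        have hr0 : 0 < r := hε.trans hr.1
        have hfp := h.pos r hr0 (hr.2.trans haR)
        have hode := h.ode r hr0
        rw [hDeq r hr0]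
        set k := deriv f r / f r with hk
        have e1 : r * deriv f r / f r = r * k := by rw [hk]; ring
        have e2 : ((1 * deriv f r + r * deriv (deriv f) r) * f r - r * deriv f r * deriv f r)
            / f r ^ 2 = (m : ℝ) ^ 2 / r - lam * r - r * k ^ 2 := by
          rw [hk]
          field_simp
          linear_combination f r * hode
        rw [e1, e2]
        have hsq : 0 ≤ ‖c' r - k • c r‖ ^ 2 := by positivity
        rw [norm_sub_sq_real, inner_smul_right, norm_smul, mul_pow, Real.norm_eq_abs, sq_abs,
          real_inner_comm] at hsq
        nlinarith [mul_nonneg hr0.le hsq]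
    have h2 := h.rderiv_le hlam hε (hεa.trans haR)
    have hfε := h.pos ε hε (hεa.trans haR)
    have h3 : ε * deriv f ε / f ε ≤ m := by rwa [div_le_iff₀ hfε]
    rw [hca] at h1
    have h4 : ‖c ε‖ ^ 2 * (ε * deriv f ε / f ε) ≤ ‖c ε‖ ^ 2 * m := by gcongr
    simp only [norm_zero] at h1
    nlinarith
  have hcc : Continuous c := continuous_iff_continuousAt.2 fun r => (hc r).continuousAt
  have hl1 : Filter.Tendsto (fun ε => -(m * ‖c ε‖ ^ 2)) (nhdsWithin 0 (Set.Ioi 0)) (nhds 0) := by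
    have h0 : -(m * ‖c 0‖ ^ 2) = 0 := by
      rcases Nat.eq_zero_or_pos m with h0 | h0
      · simp [h0]
      · simp [hc0 h0.ne']
    have := ((by fun_prop : Continuous fun ε => -((m : ℝ) * ‖c ε‖ ^ 2)).tendsto 0)
    rw [h0] at this
    exact this.mono_left nhdsWithin_le_nhds
  have hl2 : Filter.Tendsto (fun ε => ∫ r in ε..a, D r) (nhdsWithin 0 (Set.Ioi 0))
      (nhds (∫ r in (0)..a, D r)) := by
    have hcont : Continuous fun ε => ∫ r in ε..a, D r := by
      have := (intervalIntegral.continuous_primitive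
        (fun x y => hD.intervalIntegrable (μ := volume) x y) a).neg
      refine this.congr fun ε => ?_
      exact (intervalIntegral.integral_symm _ _).symm
    exact (hcont.tendsto 0).mono_left nhdsWithin_le_nhds
  refine le_of_tendsto_of_tendsto hl1 hl2 ?_
  filter_upwards [Ioo_mem_nhdsGT ha] with ε hε
  exact hineq ε hε.1 hε.2

end BF
end

section
open MeasureTheory

noncomputable def ex (n : ℤ) (φ : ℝ) : ℂ := Complex.exp (-(Complex.I * n * φ))

lemma continuous_ex (n : ℤ) : Continuous (ex n) := by unfold ex; fun_prop

lemma norm_ex (n : ℤ) (φ : ℝ) : ‖ex n φ‖ = 1 := by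
  rw [ex, Complex.norm_exp]
  simp

lemma hasDerivAt_ex (n : ℤ) (φ : ℝ) : HasDerivAt (ex n) (ex n φ * (-(Complex.I * n))) φ := by
  unfold ex
  apply HasDerivAt.cexp
  have h := ((hasDerivAt_id φ).ofReal_comp.const_mul (Complex.I * n)).neg
  refine h.congr_deriv ?_
  simp

noncomputable def fc (W : ℝ → ℝ → ℂ) (n : ℤ) (r : ℝ) : ℂ :=
  ∫ φ in (-Real.pi)..Real.pi, W r φ * ex n φ

lemma parseval {W : ℝ → ℂ} (hW : Continuous W) :
    HasSum (fun n : ℤ => ‖∫ φ in (-Real.pi)..Real.pi, W φ * ex n φ‖ ^ 2)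
      (2 * Real.pi * ∫ φ in (-Real.pi)..Real.pi, ‖W φ‖ ^ 2) := by
  have hpi := Real.pi_pos
  have hab : -Real.pi < Real.pi := by linarith
  have hL : MemLp W 2 (volume.restrict (Set.Ioc (-Real.pi) Real.pi)) := by
    rw [memLp_two_iff_integrable_sq_norm hW.aestronglyMeasurable]
    exact ((by fun_prop : Continuous fun x => ‖W x‖ ^ 2).integrableOn_Icc
      (a := -Real.pi) (b := Real.pi)).mono_set Set.Ioc_subset_Icc_self
  have h := (hasSum_sq_fourierCoeffOn hab hL).mul_left ((2 * Real.pi) ^ 2)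
  have e1 : (fun n : ℤ => ‖∫ φ in (-Real.pi)..Real.pi, W φ * ex n φ‖ ^ 2)
      = fun n : ℤ => (2 * Real.pi) ^ 2 * ‖fourierCoeffOn hab W n‖ ^ 2 := by
    ext n
    rw [fourierCoeffOn_eq_integral, norm_smul, mul_pow ‖_‖]
    have : ∀ x : ℝ, (fourier (-n)) (x : AddCircle (Real.pi - -Real.pi)) • W x
        = W x * ex n x := by
      intro x
      rw [fourier_coe_apply, smul_eq_mul, mul_comm, ex]
      congr 2
      have : (Real.pi : ℂ) ≠ 0 := by exact_mod_cast hpi.ne'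
      push_cast
      field_simp
      ring
    simp only [this]
    rw [← mul_assoc]
    have e : (2 * Real.pi) ^ 2 * ‖1 / (Real.pi - -Real.pi)‖ ^ 2 = 1 := by
      rw [Real.norm_eq_abs, sq_abs]
      field_simp
      ring
    rw [e, one_mul]
  have e2 : 2 * Real.pi * ∫ φ in (-Real.pi)..Real.pi, ‖W φ‖ ^ 2 = (2 * Real.pi) ^ 2 *
      ((Real.pi - -Real.pi)⁻¹ • ∫ φ in (-Real.pi)..Real.pi, ‖W φ‖ ^ 2) := by
    rw [smul_eq_mul, ← mul_assoc]
    congr 1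
    field_simp
    ring
  rw [e1, e2]
  exact h

lemma continuous_fc {W : ℝ → ℝ → ℂ} (hW : Continuous (fun q : ℝ × ℝ => W q.1 q.2)) (n : ℤ) :
    Continuous (fc W n) := by
  unfold fc
  apply intervalIntegral.continuous_parametric_intervalIntegral_of_continuous'
  have := continuous_ex n
  simp only [Function.uncurry_def]
  fun_prop

lemma parseval2 {W : ℝ → ℝ → ℂ} (hW : Continuous (fun q : ℝ × ℝ => W q.1 q.2)) {a : ℝ}
    (ha : 0 ≤ a) :
    HasSum (fun n : ℤ => ∫ r in (0)..a, r * ‖fc W n r‖ ^ 2)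
      (∫ r in (0)..a, r * (2 * Real.pi * ∫ φ in (-Real.pi)..Real.pi, ‖W r φ‖ ^ 2)) := by
  have hs : ∀ r, HasSum (fun n : ℤ => r * ‖fc W n r‖ ^ 2)
      (r * (2 * Real.pi * ∫ φ in (-Real.pi)..Real.pi, ‖W r φ‖ ^ 2)) := by
    intro r
    have : Continuous (W r) := hW.comp (by fun_prop : Continuous fun φ : ℝ => (r, φ))
    exact (parseval this).mul_left r
  apply intervalIntegral.hasSum_integral_of_dominated_convergence
    (fun n r => r * ‖fc W n r‖ ^ 2)
  · intro n
    have := continuous_fc hW n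
    exact (by fun_prop : Continuous fun r => r * ‖fc W n r‖ ^ 2).aestronglyMeasurable
  · intro n
    refine Filter.Eventually.of_forall fun r hr => ?_
    rw [Set.uIoc_of_le ha] at hr
    have := hr.1
    rw [Real.norm_of_nonneg (by positivity)]
  · exact Filter.Eventually.of_forall fun r _ => (hs r).summable
  · simp only [fun r => (hs r).tsum_eq]
    have : Continuous fun r => ∫ φ in (-Real.pi)..Real.pi, ‖W r φ‖ ^ 2 := by
      apply intervalIntegral.continuous_parametric_intervalIntegral_of_continuous'
      simp only [Function.uncurry_def]
      fun_prop
    exact (by fun_prop : Continuous fun r =>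
      r * (2 * Real.pi * ∫ φ in (-Real.pi)..Real.pi, ‖W r φ‖ ^ 2)).intervalIntegrable _ _
  · exact Filter.Eventually.of_forall fun r _ => hs r

lemma continuous_upol (x₀ y₀ : ℝ) {u : ℝ × ℝ → ℂ} (hu : Continuous u) :
    Continuous (fun q : ℝ × ℝ => u (pol x₀ y₀ q.1 q.2)) := hu.comp (continuous_pol x₀ y₀)

lemma cont_slice {W : ℝ → ℝ → ℂ} (hW : Continuous (fun q : ℝ × ℝ => W q.1 q.2)) (r : ℝ) :
    Continuous (W r) := hW.comp (by fun_prop : Continuous fun φ : ℝ => (r, φ))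

lemma fc_deriv_gen {W W' : ℝ → ℝ → ℂ} (hW : ∀ r, Continuous (W r)) (hW' : ∀ r, Continuous (W' r))
    (hd : ∀ r φ, HasDerivAt (fun r => W r φ) (W' r φ) r) {C : ℝ} (hC : ∀ r φ, ‖W' r φ‖ ≤ C)
    (n : ℤ) (r : ℝ) : HasDerivAt (fc W n) (fc W' n r) r := by
  have hce := continuous_ex n
  have h := (intervalIntegral.hasDerivAt_integral_of_dominated_loc_of_deriv_le (μ := volume)
    (a := -Real.pi) (b := Real.pi) (x₀ := r)
    (s := Set.univ) (bound := fun _ => C)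
    (F := fun r φ => W r φ * ex n φ)
    (F' := fun r φ => W' r φ * ex n φ)
    Filter.univ_mem
    (Filter.Eventually.of_forall fun r => ((hW r).mul hce).aestronglyMeasurable)
    (((hW r).mul hce).intervalIntegrable _ _)
    ((hW' r).mul hce).aestronglyMeasurable
    (Filter.Eventually.of_forall fun φ _ x _ => by
      rw [norm_mul, norm_ex, mul_one]; exact hC x φ)
    intervalIntegrable_const
    (Filter.Eventually.of_forall fun φ _ x _ => (hd x φ).mul_const _)).2
  exact h

lemma fc_deriv {u : ℝ × ℝ → ℂ} (hu : ContDiff ℝ 1 u) (hc : HasCompactSupport u) (n : ℤ) (r : ℝ) :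
    HasDerivAt (fc (fun r φ => u (pol 0 0 r φ)) n) (fc (dR 0 0 u) n r) r := by
  obtain ⟨C2, hC2⟩ := (hcs_dX hc).exists_bound_of_continuous (continuous_dX hu)
  obtain ⟨C3, hC3⟩ := (hcs_dY hc).exists_bound_of_continuous (continuous_dY hu)
  have hcu := continuous_upol 0 0 hu.continuous
  have hcr := continuous_dR 0 0 hu
  have hdiff := hu.differentiable one_ne_zero
  have hder : ∀ r φ, HasDerivAt (fun r => u (pol 0 0 r φ)) (dR 0 0 u r φ) r :=
    fun r φ => hasDerivAt_pol_r 0 0 (hdiff (pol 0 0 r φ))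
  refine fc_deriv_gen (C := C2 + C3) (W := fun r φ => u (pol 0 0 r φ)) (W' := dR 0 0 u)
    (fun r => cont_slice (W := fun r φ => u (pol 0 0 r φ)) hcu r)
    (fun r => cont_slice (W := dR 0 0 u) hcr r) hder (fun r φ => ?_) n r
  unfold dR
  refine (norm_add_le _ _).trans ?_
  rw [norm_mul, norm_mul, Complex.norm_real, Complex.norm_real]
  have h1 := Real.abs_cos_le_one φ
  have h2 := Real.abs_sin_le_one φ
  refine add_le_add ?_ ?_
  · exact (mul_le_of_le_one_left (norm_nonneg _) h1).trans (hC2 _)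
  · exact (mul_le_of_le_one_left (norm_nonneg _) h2).trans (hC3 _)

lemma ex_pi (n : ℤ) : ex n Real.pi = ex n (-Real.pi) := by
  rw [ex, ex, Complex.exp_eq_exp_iff_exists_int]
  refine ⟨-n, ?_⟩
  push_cast
  ring

lemma parts_gen {w v : ℝ → ℂ} (hv : Continuous v) (hw : Continuous w)
    (hd : ∀ φ, HasDerivAt w (v φ) φ) (hb : w Real.pi = w (-Real.pi)) (n : ℤ) :
    ∫ φ in (-Real.pi)..Real.pi, v φ * ex n φ
      = Complex.I * n * ∫ φ in (-Real.pi)..Real.pi, w φ * ex n φ := by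
  have hce := continuous_ex n
  have hI := intervalIntegral.integral_deriv_mul_eq_sub (a := -Real.pi) (b := Real.pi)
    (u := w) (u' := v) (v := ex n) (v' := fun φ : ℝ => ex n φ * (-(Complex.I * n)))
    (fun φ _ => hd φ) (fun φ _ => hasDerivAt_ex n φ)
    (hv.intervalIntegrable _ _)
    ((hce.mul continuous_const).intervalIntegrable _ _)
  have i1 : IntervalIntegrable (fun φ => v φ * ex n φ) volume (-Real.pi) Real.pi :=
    (hv.mul hce).intervalIntegrable _ _
  have i2 : IntervalIntegrable (fun φ => w φ * (ex n φ * (-(Complex.I * n)))) volume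
    (-Real.pi) Real.pi := (hw.mul (hce.mul continuous_const)).intervalIntegrable _ _
  rw [hb, ex_pi, sub_self, intervalIntegral.integral_add i1 i2] at hI
  have e2 : ∫ φ in (-Real.pi)..Real.pi, w φ * (ex n φ * (-(Complex.I * n)))
      = -(Complex.I * n) * ∫ φ in (-Real.pi)..Real.pi, w φ * ex n φ := by
    rw [← intervalIntegral.integral_const_mul]
    congr 1
    ext φ
    ring
  rw [e2] at hI
  linear_combination hI

lemma fc_dV {u : ℝ × ℝ → ℂ} (hu : ContDiff ℝ 1 u) (n : ℤ) (r : ℝ) :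
    (r : ℂ) * fc (dV 0 0 u) n r = Complex.I * n * fc (fun r φ => u (pol 0 0 r φ)) n r := by
  have hcu := continuous_upol 0 0 hu.continuous
  have hcr := continuous_dV 0 0 hu
  have hcu' : Continuous fun φ => u (pol 0 0 r φ) :=
    cont_slice (W := fun r φ => u (pol 0 0 r φ)) hcu r
  have hcr' : Continuous fun φ => dV 0 0 u r φ :=
    cont_slice (W := dV 0 0 u) hcr r
  have h1 : Continuous (fun φ => (r : ℂ) * dV 0 0 u r φ) := continuous_const.mul hcr'
  have hdiff := hu.differentiable one_ne_zero
  have h2 : ∀ φ, HasDerivAt (fun φ => u (pol 0 0 r φ)) ((r : ℂ) * dV 0 0 u r φ) φ :=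
    fun φ => hasDerivAt_pol_phi 0 0 (hdiff (pol 0 0 r φ))
  have h3 : u (pol 0 0 r Real.pi) = u (pol 0 0 r (-Real.pi)) := by simp [pol]
  have h := parts_gen h1 hcu' h2 h3 n
  unfold fc
  rw [← h, ← intervalIntegral.integral_const_mul]
  congr 1
  ext φ
  ring

lemma eDens_sq (κ : ℝ) (v c : ℂ) :
    ‖v - Complex.I * κ * c‖ ^ 2 = ‖v‖ ^ 2 + κ ^ 2 * ‖c‖ ^ 2
      + 2 * κ * (Complex.I * v * (starRingEnd ℂ) c).re := by
  simp only [← Complex.normSq_eq_norm_sq, Complex.normSq_apply, Complex.mul_re, Complex.mul_im,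
    Complex.I_re, Complex.I_im, Complex.ofReal_re, Complex.ofReal_im, Complex.sub_re,
    Complex.sub_im, Complex.conj_re, Complex.conj_im]
  ring
end

section
open MeasureTheory

lemma exists_radius {u : ℝ × ℝ → ℂ} (hc : HasCompactSupport u) {R₀ : ℝ} (hR₀ : 0 < R₀)
    (hs : tsupport u ⊆ {p : ℝ × ℝ | p.1 ^ 2 + p.2 ^ 2 < R₀ ^ 2}) :
    ∃ a, 0 < a ∧ a < R₀ ∧ ∀ r φ, a ≤ r → pol 0 0 r φ ∉ tsupport u := by
  have hK : IsCompact (insert (0 : ℝ × ℝ) (tsupport u)) := IsCompact.insert hc _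
  obtain ⟨q, hq, hmax⟩ := hK.exists_isMaxOn ⟨0, Set.mem_insert _ _⟩
    (by fun_prop : ContinuousOn (fun p : ℝ × ℝ => p.1 ^ 2 + p.2 ^ 2) _)
  set b := q.1 ^ 2 + q.2 ^ 2 with hb
  have hb0 : 0 ≤ b := by positivity
  have hbR : b < R₀ ^ 2 := by
    rcases hq with h | h
    · rw [hb, h]; simpa using pow_pos hR₀ 2
    · exact hs h
  have hR2 : 0 < R₀ ^ 2 := by positivity
  refine ⟨Real.sqrt ((b + R₀ ^ 2) / 2), Real.sqrt_pos.2 (by linarith), ?_, fun r φ hr hmem => ?_⟩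
  · rw [Real.sqrt_lt' hR₀]; linarith
  · have h1 := hmax (Set.mem_insert_of_mem _ hmem)
    simp only [Set.mem_ofPred_eq, pol, zero_add] at h1
    have h2 : (r * Real.cos φ) ^ 2 + (r * Real.sin φ) ^ 2 = r ^ 2 := by
      linear_combination r ^ 2 * Real.sin_sq_add_cos_sq φ
    have h3 : (b + R₀ ^ 2) / 2 ≤ r ^ 2 := (Real.sqrt_le_iff.1 hr).2
    rw [h2] at h1
    change r ^ 2 ≤ b at h1
    linarith

lemma fc_lin {V U : ℝ → ℝ → ℂ} (hV : Continuous (fun q : ℝ × ℝ => V q.1 q.2))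
    (hU : Continuous (fun q : ℝ × ℝ => U q.1 q.2)) (κ : ℝ → ℂ) (n : ℤ) (r : ℝ) :
    fc (fun r φ => V r φ - κ r * U r φ) n r = fc V n r - κ r * fc U n r := by
  have hce := continuous_ex n
  have h1 := cont_slice hV r
  have h2 := cont_slice hU r
  unfold fc
  rw [← intervalIntegral.integral_const_mul, ← intervalIntegral.integral_sub]
  · congr 1
    ext φ
    ring
  · exact (h1.mul hce).intervalIntegrable _ _
  · exact (continuous_const.mul (h2.mul hce)).intervalIntegrable _ _

lemma fc_mul {U : ℝ → ℝ → ℂ} (κ : ℝ → ℂ) (n : ℤ) (r : ℝ) :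
    fc (fun r φ => κ r * U r φ) n r = κ r * fc U n r := by
  unfold fc
  rw [← intervalIntegral.integral_const_mul]
  congr 1
  ext φ
  ring

lemma cont_sq_int {W : ℝ → ℝ → ℂ} (hW : Continuous (fun q : ℝ × ℝ => W q.1 q.2)) :
    Continuous fun r => ∫ φ in (-Real.pi)..Real.pi, ‖W r φ‖ ^ 2 := by
  apply intervalIntegral.continuous_parametric_intervalIntegral_of_continuous'
  simp only [Function.uncurry_def]
  fun_prop

lemma term_nonneg {c c' v : ℝ → ℂ} (n : ℤ) (hc : ∀ r, HasDerivAt c (c' r) r)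
    (hcc' : Continuous c') (hcv : Continuous v)
    (hv : ∀ r : ℝ, (r : ℂ) * v r = Complex.I * n * c r) {a R₀ lam ω L : ℝ}
    (ha : 0 < a) (haR : a < R₀) (hca : c a = 0) {f : ℝ → ℝ} {m : ℕ} (hm : m = n.natAbs)
    (hf : BF f m lam R₀) (hlam : 0 ≤ lam) (hω : 0 < ω) (hL : L ≤ lam - m * ω) :
    0 ≤ ∫ r in (0)..a, (r * ‖c' r‖ ^ 2 + r * ‖v r - Complex.I * ((ω * r / 2 : ℝ) : ℂ) * c r‖ ^ 2
      - r * ‖((ω * r / 2 : ℝ) : ℂ) * c r‖ ^ 2 - L * (r * ‖c r‖ ^ 2)) := by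
  have hcc : Continuous c := continuous_iff_continuousAt.2 fun r => (hc r).continuousAt
  have hmn : ((m : ℝ)) ^ 2 = (n : ℝ) ^ 2 := by
    rw [hm, Nat.cast_natAbs, Int.cast_abs, sq_abs]
  have hnm : (n : ℝ) ≤ m := by
    rw [hm, Nat.cast_natAbs, Int.cast_abs]; exact le_abs_self _
  have hc0 : m ≠ 0 → c 0 = 0 := by
    intro h0
    have h1 := hv 0
    simp only [Complex.ofReal_zero, zero_mul] at h1
    have hn : (n : ℂ) ≠ 0 := by
      rw [Ne, Int.cast_eq_zero]; rintro rfl; exact h0 (by simpa using hm)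
    rcases mul_eq_zero.1 h1.symm with h2 | h2
    · exact absurd h2 (mul_ne_zero Complex.I_ne_zero hn)
    · exact h2
  have key : ∀ r : ℝ, 0 < r → v r = Complex.I * ((n / r : ℝ) : ℂ) * c r := by
    intro r hr
    have hr' : (r : ℂ) ≠ 0 := by exact_mod_cast hr.ne'
    apply mul_left_cancel₀ hr'
    rw [hv r]
    push_cast
    field_simp
  have hp := hf.picone hlam ha haR hc hca hc0
    (D := fun r => r * ‖c' r‖ ^ 2 + r * ‖v r‖ ^ 2 - lam * r * ‖c r‖ ^ 2) (by fun_prop)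
    (fun r hr => by
      simp only [key r hr, norm_mul, Complex.norm_I, Complex.norm_real, Real.norm_eq_abs, one_mul,
        mul_pow, sq_abs, div_pow, hmn]
      field_simp)
  refine hp.trans ?_
  apply intervalIntegral.integral_mono_on ha.le
  · exact (by fun_prop : Continuous fun r : ℝ =>
      r * ‖c' r‖ ^ 2 + r * ‖v r‖ ^ 2 - lam * r * ‖c r‖ ^ 2).intervalIntegrable _ _
  · exact (by fun_prop : Continuous fun r : ℝ =>
      (r * ‖c' r‖ ^ 2 + r * ‖v r - Complex.I * ((ω * r / 2 : ℝ) : ℂ) * c r‖ ^ 2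
      - r * ‖((ω * r / 2 : ℝ) : ℂ) * c r‖ ^ 2 - L * (r * ‖c r‖ ^ 2))).intervalIntegrable _ _
  · intro r hr
    rcases hr.1.eq_or_lt with h | h
    · subst h; simp
    · have e1 : v r - Complex.I * ((ω * r / 2 : ℝ) : ℂ) * c r =
          Complex.I * ((n / r - ω * r / 2 : ℝ) : ℂ) * c r := by
        rw [key r h]; push_cast; ring
      rw [e1, key r h]
      simp only [norm_mul, Complex.norm_I, Complex.norm_real, Real.norm_eq_abs, one_mul,
        mul_pow, sq_abs]
      have : 0 ≤ (lam - n * ω - L) * (r * ‖c r‖ ^ 2) := by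
        have : (n : ℝ) * ω ≤ m * ω := by gcongr
        have h0 : 0 ≤ lam - n * ω - L := by linarith
        positivity
      have e2 : (n / r - ω * r / 2) ^ 2 = (n / r) ^ 2 - n * ω + (ω * r / 2) ^ 2 := by
        field_simp; ring
      rw [e2]
      nlinarith [this]

lemma lower {u : ℝ × ℝ → ℂ} (hu : ContDiff ℝ 1 u) (hc : HasCompactSupport u) {R₀ ω L : ℝ}
    (hR₀ : 0 < R₀) (hs : tsupport u ⊆ {p : ℝ × ℝ | p.1 ^ 2 + p.2 ^ 2 < R₀ ^ 2}) (hω : 0 < ω)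
    (hL : ∀ m : ℕ, ∃ f lam, BF f m lam R₀ ∧ 0 ≤ lam ∧ L ≤ lam - m * ω) :
    L * nrm u ≤ en ω 0 0 u := by
  obtain ⟨a, ha, haR, hout⟩ := exists_radius hc hR₀ hs
  set U : ℝ → ℝ → ℂ := fun r φ => u (pol 0 0 r φ) with hUdef
  have cU : Continuous (fun q : ℝ × ℝ => U q.1 q.2) := continuous_upol 0 0 hu.continuous
  have cR := continuous_dR 0 0 hu
  have cV := continuous_dV 0 0 hu
  set κ : ℝ → ℂ := fun r => ((ω * r / 2 : ℝ) : ℂ) with hκ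
  have cκ : Continuous κ := by rw [hκ]; fun_prop
  have cW : Continuous (fun q : ℝ × ℝ =>
      dV 0 0 u q.1 q.2 - (Complex.I * κ q.1) * U q.1 q.2) := by fun_prop
  have cKU : Continuous (fun q : ℝ × ℝ => κ q.1 * U q.1 q.2) := by fun_prop
  have p1 := parseval2 cR ha.le
  have p2 := parseval2 (W := fun r φ => dV 0 0 u r φ - (Complex.I * κ r) * U r φ) cW ha.le
  have p3 := parseval2 (W := fun r φ => κ r * U r φ) cKU ha.le
  have p4 := (parseval2 cU ha.le).mul_left L
  have hsum := ((p1.add p2).sub p3).sub p4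
  have hnn := hsum.nonneg (fun n => ?_)
  · have enrm : nrm u = ∫ r in (0)..a, r * ∫ φ in (-Real.pi)..Real.pi, ‖U r φ‖ ^ 2 := by
      refine polar_int_r 0 0 (fun p => ‖u p‖ ^ 2) ha.le ?_ ?_
      · intro r φ h
        simp [image_eq_zero_of_notMem_tsupport (hout r φ h.le)]
      · exact polar_integrable 0 0 (hu.continuous.norm.pow 2) a
    have een : en ω 0 0 u = ∫ r in (0)..a, r * ∫ φ in (-Real.pi)..Real.pi,
        eDens ω 0 0 u (pol 0 0 r φ) := by
      refine polar_int_r 0 0 (eDens ω 0 0 u) ha.le ?_ ?_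
      · intro r φ h
        exact zero_eDens ω 0 0 (hout r φ h.le)
      · exact polar_integrable 0 0 (continuous_eDens hu ω 0 0) a
    have hin : ∀ r, ∫ φ in (-Real.pi)..Real.pi, eDens ω 0 0 u (pol 0 0 r φ) =
        (∫ φ in (-Real.pi)..Real.pi, ‖dR 0 0 u r φ‖ ^ 2)
        + (∫ φ in (-Real.pi)..Real.pi, ‖dV 0 0 u r φ - (Complex.I * κ r) * U r φ‖ ^ 2)
        - ∫ φ in (-Real.pi)..Real.pi, ‖κ r * U r φ‖ ^ 2 := by
      intro r
      have s1 := cont_slice cR r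
      have s2 := cont_slice (W := fun r φ => dV 0 0 u r φ - (Complex.I * κ r) * U r φ) cW r
      have s3 := cont_slice (W := fun r φ => κ r * U r φ) cKU r
      have i1 : IntervalIntegrable (fun φ => ‖dR 0 0 u r φ‖ ^ 2) volume (-Real.pi) Real.pi :=
        (s1.norm.pow 2).intervalIntegrable _ _
      have i2 : IntervalIntegrable (fun φ => ‖dV 0 0 u r φ - (Complex.I * κ r) * U r φ‖ ^ 2)
        volume (-Real.pi) Real.pi := (s2.norm.pow 2).intervalIntegrable _ _
      have i3 : IntervalIntegrable (fun φ => ‖κ r * U r φ‖ ^ 2) volume (-Real.pi) Real.pi :=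
        (s3.norm.pow 2).intervalIntegrable _ _
      rw [← intervalIntegral.integral_add i1 i2, ← intervalIntegral.integral_sub (i1.add i2) i3]
      congr 1
      ext φ
      rw [eDens_pol, hκ, eDens_sq, norm_mul, Complex.norm_real, mul_pow, Real.norm_eq_abs, sq_abs]
      have : Complex.I * (ω : ℂ) * ((r : ℂ) * dV 0 0 u r φ) * (starRingEnd ℂ) (u (pol 0 0 r φ))
        = ((ω * r : ℝ) : ℂ) * (Complex.I * dV 0 0 u r φ * (starRingEnd ℂ) (u (pol 0 0 r φ))) := by
        push_cast; ring
      rw [this, Complex.re_ofReal_mul]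
      simp only [hUdef]
      ring
    have c1 := cont_sq_int cR
    have c2 := cont_sq_int (W := fun r φ => dV 0 0 u r φ - (Complex.I * κ r) * U r φ) cW
    have c3 := cont_sq_int (W := fun r φ => κ r * U r φ) cKU
    have c4 := cont_sq_int cU
    have efin : (∫ r in (0)..a, r * (2 * Real.pi * ∫ φ in (-Real.pi)..Real.pi, ‖dR 0 0 u r φ‖ ^ 2))
        + (∫ r in (0)..a, r * (2 * Real.pi * ∫ φ in (-Real.pi)..Real.pi,
            ‖dV 0 0 u r φ - (Complex.I * κ r) * U r φ‖ ^ 2))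
        - (∫ r in (0)..a, r * (2 * Real.pi * ∫ φ in (-Real.pi)..Real.pi, ‖κ r * U r φ‖ ^ 2))
        - L * (∫ r in (0)..a, r * (2 * Real.pi * ∫ φ in (-Real.pi)..Real.pi, ‖U r φ‖ ^ 2))
        = 2 * Real.pi * (en ω 0 0 u - L * nrm u) := by
      have j1 : ∀ {g : ℝ → ℝ}, Continuous g → IntervalIntegrable (fun r : ℝ => r * g r) volume 0 a :=
        fun hg => (continuous_id.mul hg).intervalIntegrable _ _
      have j2 : ∀ g : ℝ → ℝ, ∫ r in (0)..a, r * (2 * Real.pi * g r)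
          = 2 * Real.pi * ∫ r in (0)..a, r * g r := by
        intro g
        rw [← intervalIntegral.integral_const_mul]
        congr 1; ext r; ring
      rw [j2, j2, j2, j2, een, enrm]
      simp only [hin, mul_sub, mul_add]
      rw [intervalIntegral.integral_sub ((j1 c1).add (j1 c2)) (j1 c3),
        intervalIntegral.integral_add (j1 c1) (j1 c2)]
      ring
    have hnn' := efin ▸ hnn
    have := nonneg_of_mul_nonneg_right hnn' (by have := Real.pi_pos; positivity)
    linarith
  · obtain ⟨f, lam, hf, hlam, hL'⟩ := hL n.natAbs
    have q1 := continuous_fc cU n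
    have q2 := continuous_fc cR n
    have q3 := continuous_fc cV n
    have hca : fc U n a = 0 := by
      unfold fc
      have : ∀ φ, U a φ = 0 := fun φ =>
        image_eq_zero_of_notMem_tsupport (f := u) (hout a φ le_rfl)
      simp [this]
    have ht := term_nonneg n (fc_deriv hu hc n) q2 q3 (fc_dV hu n) ha haR hca rfl hf hlam hω hL'
    refine ht.trans_eq ?_
    simp only [fc_lin cV cU (fun r => Complex.I * κ r) n, fc_mul κ n]
    have i1 : IntervalIntegrable (fun r => r * ‖fc (dR 0 0 u) n r‖ ^ 2) volume 0 a :=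
      (by fun_prop : Continuous _).intervalIntegrable _ _
    have i2 : IntervalIntegrable (fun r => r * ‖fc (dV 0 0 u) n r
      - Complex.I * κ r * fc U n r‖ ^ 2) volume 0 a :=
      (by fun_prop : Continuous _).intervalIntegrable _ _
    have i3 : IntervalIntegrable (fun r => r * ‖κ r * fc U n r‖ ^ 2) volume 0 a :=
      (by fun_prop : Continuous _).intervalIntegrable _ _
    have i4 : IntervalIntegrable (fun r => L * (r * ‖fc U n r‖ ^ 2)) volume 0 a :=
      (by fun_prop : Continuous _).intervalIntegrable _ _
    rw [intervalIntegral.integral_sub ((i1.add i2).sub i3) i4,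
      intervalIntegral.integral_sub (i1.add i2) i3, intervalIntegral.integral_add i1 i2,
      intervalIntegral.integral_const_mul]
end

section
open MeasureTheory

lemma R_angle {R : ℝ → ℝ} (hRper : Function.Periodic R (2 * Real.pi)) {θ ψ : ℝ}
    (h : (θ : Real.Angle) = ψ) : R θ = R ψ := by
  rw [Real.Angle.angle_eq_iff_two_pi_dvd_sub] at h
  obtain ⟨k, hk⟩ := h
  have : θ = ψ + k * (2 * Real.pi) := by linarith
  rw [this]
  exact hRper.int_mul k ψ

lemma R_bounds {R : ℝ → ℝ} (hRc : Continuous R) (hRper : Function.Periodic R (2 * Real.pi))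
    (hRpos : ∀ φ, 0 < R φ) : ∃ ρ M, 0 < ρ ∧ ∀ φ, ρ ≤ R φ ∧ R φ ≤ M := by
  have hpi := Real.pi_pos
  have hne : (Set.Icc 0 (2 * Real.pi)).Nonempty := ⟨0, by simp; positivity⟩
  obtain ⟨p, _, hp⟩ := isCompact_Icc.exists_isMinOn hne hRc.continuousOn
  obtain ⟨q, _, hq⟩ := isCompact_Icc.exists_isMaxOn hne hRc.continuousOn
  refine ⟨R p, R q, hRpos p, fun φ => ?_⟩
  obtain ⟨y, hy, he⟩ := hRper.exists_mem_Ico₀ (by positivity) φ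
  rw [he]
  exact ⟨hp ⟨hy.1, hy.2.le⟩, hq ⟨hy.1, hy.2.le⟩⟩

lemma R_arg_contDiffAt {R : ℝ → ℝ} (hRC1 : ContDiff ℝ 1 R)
    (hRper : Function.Periodic R (2 * Real.pi)) {z : ℂ} (hz : z ≠ 0) :
    ContDiffAt ℝ 1 (fun z : ℂ => R z.arg) z := by
  have key : ∀ w : ℂ, w ∈ Complex.slitPlane → ContDiffAt ℝ 1 (fun z : ℂ => z.arg) w := by
    intro w hw
    have h1 : ContDiffAt ℝ 1 Complex.log w := (Complex.contDiffAt_log hw).restrict_scalars ℝ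
    have h2 : ContDiffAt ℝ 1 (fun z => Complex.imCLM (Complex.log z)) w :=
      Complex.imCLM.contDiff.contDiffAt.comp w h1
    simpa only [Complex.imCLM_apply, Complex.log_im] using h2
  by_cases hs : z ∈ Complex.slitPlane
  · exact hRC1.contDiffAt.comp z (key z hs)
  · have hs' : -z ∈ Complex.slitPlane := by
      rw [Complex.mem_slitPlane_iff] at hs ⊢
      push Not at hs
      left
      have : z.re ≠ 0 := fun h => hz (Complex.ext h hs.2)
      simp only [Complex.neg_re]
      have := lt_of_le_of_ne hs.1 this
      linarith
    have h3 : ContDiffAt ℝ 1 (fun z : ℂ => R ((-z).arg + Real.pi)) z := by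
      have hn : ContDiffAt ℝ 1 (fun z : ℂ => -z) z := contDiffAt_id.neg
      have h4 : ContDiffAt ℝ 1 (fun z : ℂ => (-z).arg) z :=
        ContDiffAt.comp (g := fun z : ℂ => z.arg) z (key (-z) hs') hn
      exact hRC1.contDiffAt.comp z (h4.add contDiffAt_const)
    refine h3.congr_of_eventuallyEq ?_
    filter_upwards [isOpen_ne.mem_nhds hz] with w hw
    apply R_angle hRper
    rw [Real.Angle.coe_add, Complex.arg_neg_coe_angle hw, add_assoc]
    simp

noncomputable def zc (x₀ y₀ : ℝ) (p : ℝ × ℝ) : ℂ := ⟨p.1 - x₀, p.2 - y₀⟩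

lemma zc_pol (x₀ y₀ r φ : ℝ) : zc x₀ y₀ (pol x₀ y₀ r φ) =
    r * (Real.cos φ + Real.sin φ * Complex.I) := by
  apply Complex.ext <;> simp [zc, pol, ← Complex.ofReal_cos, ← Complex.ofReal_sin]

lemma pol_zc (x₀ y₀ : ℝ) (p : ℝ × ℝ) :
    pol x₀ y₀ ‖zc x₀ y₀ p‖ (zc x₀ y₀ p).arg = p := by
  simp [pol, Complex.norm_mul_cos_arg, Complex.norm_mul_sin_arg, zc]

lemma contDiff_zc (x₀ y₀ : ℝ) : ContDiff ℝ 1 (zc x₀ y₀) := by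
  have : zc x₀ y₀ = fun p => ((p.1 - x₀ : ℝ) : ℂ) + ((p.2 - y₀ : ℝ) : ℂ) * Complex.I := by
    ext p; apply Complex.ext <;> simp [zc]
  rw [this]
  have h1 : ContDiff ℝ 1 (fun p : ℝ × ℝ => Complex.ofRealCLM (p.1 - x₀)) :=
    Complex.ofRealCLM.contDiff.comp (contDiff_fst.sub contDiff_const)
  have h2 : ContDiff ℝ 1 (fun p : ℝ × ℝ => Complex.ofRealCLM (p.2 - y₀)) :=
    Complex.ofRealCLM.contDiff.comp (contDiff_snd.sub contDiff_const)
  exact h1.add (h2.mul contDiff_const)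

lemma norm_zc_pol (x₀ y₀ : ℝ) {r : ℝ} (hr : 0 ≤ r) (φ : ℝ) :
    ‖zc x₀ y₀ (pol x₀ y₀ r φ)‖ = r := by
  rw [zc_pol, norm_mul, Complex.norm_real, Real.norm_of_nonneg hr, Complex.ofReal_cos,
    Complex.ofReal_sin, Complex.norm_cos_add_sin_mul_I, mul_one]

noncomputable def tr (x₀ y₀ R₀ : ℝ) (R g : ℝ → ℝ) (m : ℕ) (p : ℝ × ℝ) : ℂ :=
  (g (R₀ * ‖zc x₀ y₀ p‖ / R (zc x₀ y₀ p).arg) : ℂ) * (zc x₀ y₀ p / ‖zc x₀ y₀ p‖) ^ m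

lemma tr_pol (x₀ y₀ R₀ : ℝ) {R : ℝ → ℝ} (g : ℝ → ℝ)
    (hRper : Function.Periodic R (2 * Real.pi)) (m : ℕ) {r : ℝ} (hr : 0 < r) (φ : ℝ) :
    tr x₀ y₀ R₀ R g m (pol x₀ y₀ r φ) =
      (g (R₀ / R φ * r) : ℂ) * Complex.exp (Complex.I * m * φ) := by
  have h1 : R (zc x₀ y₀ (pol x₀ y₀ r φ)).arg = R φ := by
    apply R_angle hRper
    rw [zc_pol]
    exact Complex.arg_mul_cos_add_sin_mul_I_coe_angle hr (φ : Real.Angle)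
  have hr' : (r : ℂ) ≠ 0 := by exact_mod_cast hr.ne'
  rw [tr, h1, norm_zc_pol x₀ y₀ hr.le, zc_pol]
  congr 1
  · congr 2; ring
  · rw [mul_div_cancel_left₀ _ hr', Complex.ofReal_cos, Complex.ofReal_sin,
      ← Complex.exp_mul_I, ← Complex.exp_nat_mul]
    congr 1; ring

section
variable {x₀ y₀ R₀ : ℝ} {R g : ℝ → ℝ} {m : ℕ} {δ c : ℝ}

lemma tr_contDiff (hRC1 : ContDiff ℝ 1 R) (hRper : Function.Periodic R (2 * Real.pi))
    (hRpos : ∀ φ, 0 < R φ) (hR₀ : 0 < R₀) (hg : ContDiff ℝ 1 g) (hδ : 0 < δ)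
    (hg0 : ∀ s, s ≤ δ → g s = c) (hc : m ≠ 0 → c = 0) :
    ContDiff ℝ 1 (tr x₀ y₀ R₀ R g m) := by
  obtain ⟨ρ, M, hρ, hb⟩ := R_bounds hRC1.continuous hRper hRpos
  have hz := contDiff_zc x₀ y₀
  rw [contDiff_iff_contDiffAt]
  intro p
  by_cases hp : zc x₀ y₀ p = 0
  · have hev : ∀ᶠ q in nhds p, ‖zc x₀ y₀ q‖ < δ * ρ / R₀ := by
      have := (hz.continuous.norm.tendsto p)
      rw [hp, norm_zero] at this
      exact this.eventually_lt_const (by positivity)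
    refine (contDiffAt_const (c := (c : ℂ))).congr_of_eventuallyEq ?_
    filter_upwards [hev] with q hq
    have h1 : g (R₀ * ‖zc x₀ y₀ q‖ / R (zc x₀ y₀ q).arg) = c := by
      apply hg0
      have h2 := (hb (zc x₀ y₀ q).arg).1
      rw [div_le_iff₀ (hRpos _)]
      rw [lt_div_iff₀ hR₀] at hq
      nlinarith
    rw [tr, h1]
    by_cases hm : m = 0
    · simp [hm]
    · simp [hc hm]
  · have h1 : ContDiffAt ℝ 1 (fun p => ‖zc x₀ y₀ p‖) p := hz.contDiffAt.norm ℝ hp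
    have h2 : ContDiffAt ℝ 1 (fun p => R (zc x₀ y₀ p).arg) p :=
      ContDiffAt.comp (g := fun z : ℂ => R z.arg) p (R_arg_contDiffAt hRC1 hRper hp) hz.contDiffAt
    have h3 : ContDiffAt ℝ 1 (fun p => R₀ * ‖zc x₀ y₀ p‖ / R (zc x₀ y₀ p).arg) p :=
      (contDiffAt_const.mul h1).div h2 (hRpos _).ne'
    have h4 : ContDiffAt ℝ 1 (fun p => g (R₀ * ‖zc x₀ y₀ p‖ / R (zc x₀ y₀ p).arg)) p :=
      hg.contDiffAt.comp p h3
    have h5 : ContDiffAt ℝ 1 (fun p => Complex.ofRealCLM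
        (g (R₀ * ‖zc x₀ y₀ p‖ / R (zc x₀ y₀ p).arg))) p :=
      Complex.ofRealCLM.contDiff.contDiffAt.comp p h4
    have h6 : ContDiffAt ℝ 1 (fun p => Complex.ofRealCLM ‖zc x₀ y₀ p‖) p :=
      Complex.ofRealCLM.contDiff.contDiffAt.comp p h1
    have h7 : ContDiffAt ℝ 1 (fun p => (zc x₀ y₀ p / Complex.ofRealCLM ‖zc x₀ y₀ p‖) ^ m) p := by
      simp only [div_eq_mul_inv]
      refine (hz.contDiffAt.mul (h6.inv ?_)).pow m
      simpa using hp
    exact h5.mul h7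

lemma tr_supp (hRc : Continuous R)
    (hRpos : ∀ φ, 0 < R φ) (hR₀ : 0 < R₀) (hδ : 0 < δ)
    (hg1 : ∀ s, R₀ - δ ≤ s → g s = 0) {Ω : Set (ℝ × ℝ)}
    (hstar : Ω = {p : ℝ × ℝ | ∃ r φ : ℝ, 0 ≤ r ∧ r < R φ ∧
      p = (x₀ + r * Real.cos φ, y₀ + r * Real.sin φ)}) :
    HasCompactSupport (tr x₀ y₀ R₀ R g m) ∧ tsupport (tr x₀ y₀ R₀ R g m) ⊆ Ω := by
  set K : Set (ℝ × ℝ) := (fun q : ℝ × ℝ => pol x₀ y₀ (q.1 * R q.2) q.2) ''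
    (Set.Icc 0 ((R₀ - δ) / R₀) ×ˢ Set.Icc (-Real.pi) Real.pi) with hK
  have hKc : IsCompact K := by
    refine (isCompact_Icc.prod isCompact_Icc).image ?_
    unfold pol
    fun_prop
  have hsub : Function.support (tr x₀ y₀ R₀ R g m) ⊆ K := by
    intro p hp
    have h1 : R₀ * ‖zc x₀ y₀ p‖ / R (zc x₀ y₀ p).arg < R₀ - δ := by
      by_contra h
      apply hp
      simp [tr, hg1 _ (not_lt.1 h)]
    have hRp := hRpos (zc x₀ y₀ p).arg
    refine ⟨(‖zc x₀ y₀ p‖ / R (zc x₀ y₀ p).arg, (zc x₀ y₀ p).arg), ⟨⟨by positivity, ?_⟩,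
      (Complex.neg_pi_lt_arg _).le, Complex.arg_le_pi _⟩, ?_⟩
    · rw [le_div_iff₀ hR₀]
      simp only
      calc _ = R₀ * ‖zc x₀ y₀ p‖ / R (zc x₀ y₀ p).arg := by ring
        _ ≤ _ := h1.le
    · simp only
      rw [div_mul_cancel₀ _ hRp.ne', pol_zc]
  have ht : tsupport (tr x₀ y₀ R₀ R g m) ⊆ K := closure_minimal hsub hKc.isClosed
  refine ⟨hKc.of_isClosed_subset (isClosed_tsupport _) ht, ht.trans ?_⟩
  rintro _ ⟨⟨t, φ⟩, ⟨⟨ht0, ht1⟩, _⟩, rfl⟩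
  have hRp := hRpos φ
  simp only at ht0 ht1
  have : t < 1 := ht1.trans_lt (by rw [div_lt_one hR₀]; linarith)
  rw [hstar]
  exact ⟨t * R φ, φ, by positivity, by nlinarith, rfl⟩

end
end

section
open MeasureTheory

section
variable {x₀ y₀ R₀ : ℝ} {R g : ℝ → ℝ} {m : ℕ} {δ c ω : ℝ}

lemma tr_dR (hRper : Function.Periodic R (2 * Real.pi)) (hg : ContDiff ℝ 1 g)
    (hu : ContDiff ℝ 1 (tr x₀ y₀ R₀ R g m)) {r : ℝ} (hr : 0 < r) (φ : ℝ) :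
    dR x₀ y₀ (tr x₀ y₀ R₀ R g m) r φ =
      ((R₀ / R φ * deriv g (R₀ / R φ * r) : ℝ) : ℂ) * Complex.exp (Complex.I * m * φ) := by
  have h1 := hasDerivAt_pol_r x₀ y₀ (φ := φ) (r := r) (hu.differentiable one_ne_zero _)
  have h2 : HasDerivAt (fun r : ℝ => g (R₀ / R φ * r)) (deriv g (R₀ / R φ * r) * (R₀ / R φ)) r := by
    have a1 : HasDerivAt (fun r : ℝ => R₀ / R φ * r) (R₀ / R φ) r := by
      simpa using (hasDerivAt_id r).const_mul (R₀ / R φ)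
    exact (hg.differentiable one_ne_zero _).hasDerivAt.comp r a1
  have h3 := h2.ofReal_comp.mul_const (Complex.exp (Complex.I * m * φ))
  have h4 : (fun r => tr x₀ y₀ R₀ R g m (pol x₀ y₀ r φ)) =ᶠ[nhds r]
      fun r => (g (R₀ / R φ * r) : ℂ) * Complex.exp (Complex.I * m * φ) := by
    filter_upwards [Ioi_mem_nhds hr] with x hx using tr_pol x₀ y₀ R₀ g hRper m hx φ
  rw [h1.unique (h3.congr_of_eventuallyEq h4)]
  push_cast
  ring

lemma tr_dV (hRC1 : ContDiff ℝ 1 R) (hRper : Function.Periodic R (2 * Real.pi))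
    (hRpos : ∀ φ, 0 < R φ) (hg : ContDiff ℝ 1 g)
    (hu : ContDiff ℝ 1 (tr x₀ y₀ R₀ R g m)) {r : ℝ} (hr : 0 < r) (φ : ℝ) :
    (r : ℂ) * dV x₀ y₀ (tr x₀ y₀ R₀ R g m) r φ =
      (((-(deriv g (R₀ / R φ * r) * (R₀ / R φ * r) * (deriv R φ / R φ)) : ℝ) : ℂ)
        + Complex.I * ((m * g (R₀ / R φ * r) : ℝ) : ℂ)) * Complex.exp (Complex.I * m * φ) := by
  have h1 := hasDerivAt_pol_phi x₀ y₀ (φ := φ) (r := r) (hu.differentiable one_ne_zero _)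
  have hR := (hRpos φ).ne'
  have h2 : HasDerivAt (fun φ : ℝ => g (R₀ / R φ * r))
      (-(deriv g (R₀ / R φ * r) * (R₀ / R φ * r) * (deriv R φ / R φ))) φ := by
    have a0 := (hRC1.differentiable one_ne_zero φ).hasDerivAt
    have a1 := ((hasDerivAt_const φ R₀).div a0 hR).mul_const r
    have a2 := (hg.differentiable one_ne_zero (R₀ / R φ * r)).hasDerivAt
    have a3 := HasDerivAt.comp (h₂ := g) φ a2 a1
    refine a3.congr_deriv ?_
    field_simp
    ring
  have h2' : HasDerivAt (fun φ : ℝ => Complex.exp (Complex.I * m * φ))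
      (Complex.exp (Complex.I * m * φ) * (Complex.I * m)) φ := by
    apply HasDerivAt.cexp
    have h := (hasDerivAt_id φ).ofReal_comp.const_mul (Complex.I * m)
    refine h.congr_deriv ?_
    simp
  have h3 := h2.ofReal_comp.mul h2'
  have h4 : (fun φ => tr x₀ y₀ R₀ R g m (pol x₀ y₀ r φ)) =
      fun φ => (g (R₀ / R φ * r) : ℂ) * Complex.exp (Complex.I * m * φ) := by
    ext φ; exact tr_pol x₀ y₀ R₀ g hRper m hr φ
  rw [h4] at h1
  rw [h1.unique h3]
  push_cast
  ring

lemma norm_exm (m : ℕ) (φ : ℝ) : ‖Complex.exp (Complex.I * m * φ)‖ = 1 := by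
  rw [Complex.norm_exp]; simp

lemma tr_nsq (hRper : Function.Periodic R (2 * Real.pi))
    (hRpos : ∀ φ, 0 < R φ) (hR₀ : 0 < R₀) {r : ℝ} (hr : 0 < r) (φ : ℝ) :
    r * ‖tr x₀ y₀ R₀ R g m (pol x₀ y₀ r φ)‖ ^ 2
      = R₀ / R φ * ((R φ / R₀) ^ 2 * (R₀ / R φ * r * g (R₀ / R φ * r) ^ 2)) := by
  have := hRpos φ
  rw [tr_pol x₀ y₀ R₀ g hRper m hr φ, norm_mul, norm_exm, mul_one, Complex.norm_real,
    Real.norm_eq_abs, sq_abs]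
  field_simp

lemma tr_eDens (hRC1 : ContDiff ℝ 1 R) (hRper : Function.Periodic R (2 * Real.pi))
    (hRpos : ∀ φ, 0 < R φ) (hR₀ : 0 < R₀) (hg : ContDiff ℝ 1 g)
    (hu : ContDiff ℝ 1 (tr x₀ y₀ R₀ R g m)) {r : ℝ} (hr : 0 < r) (φ : ℝ) :
    r * eDens ω x₀ y₀ (tr x₀ y₀ R₀ R g m) (pol x₀ y₀ r φ)
      = R₀ / R φ * ((1 + (deriv R φ / R φ) ^ 2) *
          (R₀ / R φ * r * deriv g (R₀ / R φ * r) ^ 2)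
        + (m : ℝ) ^ 2 * (g (R₀ / R φ * r) ^ 2 / (R₀ / R φ * r))
        - ω * m * (R φ / R₀) ^ 2 * (R₀ / R φ * r * g (R₀ / R φ * r) ^ 2)) := by
  have hR := hRpos φ
  have hr' : (r : ℂ) ≠ 0 := by exact_mod_cast hr.ne'
  have hv := tr_dV hRC1 hRper hRpos hg hu hr φ
  have hvn : ‖dV x₀ y₀ (tr x₀ y₀ R₀ R g m) r φ‖ ^ 2 =
      ((deriv g (R₀ / R φ * r) * (R₀ / R φ * r) * (deriv R φ / R φ)) ^ 2
        + (m * g (R₀ / R φ * r)) ^ 2) / r ^ 2 := by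
    have h1 := congrArg (fun w : ℂ => ‖w‖ ^ 2) hv
    simp only [norm_mul, norm_exm, mul_one, Complex.norm_real, mul_pow, Real.norm_eq_abs,
      sq_abs] at h1
    rw [eq_div_iff (by positivity), mul_comm, h1, ← Complex.normSq_eq_norm_sq, Complex.normSq_apply]
    simp
    ring
  rw [eDens_pol, tr_dR hRper hg hu hr, hvn, hv, tr_pol x₀ y₀ R₀ g hRper m hr φ]
  set s := R₀ / R φ * r with hs
  have hs0 : 0 < s := by positivity
  have e1 : Complex.I * (ω : ℂ) * ((((-(deriv g s * s * (deriv R φ / R φ)) : ℝ) : ℂ)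
        + Complex.I * ((m * g s : ℝ) : ℂ)) * Complex.exp (Complex.I * m * φ)) *
        (starRingEnd ℂ) ((g s : ℂ) * Complex.exp (Complex.I * m * φ))
      = Complex.I * (ω : ℂ) * ((((-(deriv g s * s * (deriv R φ / R φ)) : ℝ) : ℂ)
        + Complex.I * ((m * g s : ℝ) : ℂ))) * (g s : ℂ) := by
    have : Complex.exp (Complex.I * m * φ) * (starRingEnd ℂ) (Complex.exp (Complex.I * m * φ))
        = 1 := by
      rw [Complex.mul_conj, Complex.normSq_eq_norm_sq, norm_exm]; simp
    rw [map_mul, Complex.conj_ofReal]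
    linear_combination (Complex.I * (ω : ℂ) * ((((-(deriv g s * s * (deriv R φ / R φ)) : ℝ) : ℂ)
        + Complex.I * ((m * g s : ℝ) : ℂ))) * (g s : ℂ)) * this
  have e2 : (Complex.I * (ω : ℂ) * ((((-(deriv g s * s * (deriv R φ / R φ)) : ℝ) : ℂ)
        + Complex.I * ((m * g s : ℝ) : ℂ))) * (g s : ℂ)).re = -(ω * m * g s ^ 2) := by
    simp [Complex.mul_re, Complex.mul_im]
    ring
  rw [e1, e2, norm_mul, norm_exm, mul_one, Complex.norm_real, Real.norm_eq_abs, sq_abs]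
  have hrs : r = R φ / R₀ * s := by rw [hs]; field_simp
  rw [hrs]
  field_simp
  ring

lemma subst_int {h : ℝ → ℝ} {R₀ ρ a : ℝ} (hR₀ : 0 < R₀) (hρ : 0 < ρ) (ha : ρ ≤ a)
    (h0 : ∀ s, R₀ < s → h s = 0) :
    ∫ r in (0)..a, R₀ / ρ * h (R₀ / ρ * r) = ∫ s in (0)..R₀, h s := by
  have h1 := intervalIntegral.smul_integral_comp_mul_left (a := 0) (b := a) h (R₀ / ρ)
  rw [intervalIntegral.integral_const_mul, ← smul_eq_mul, h1, mul_zero]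
  have hb : R₀ ≤ R₀ / ρ * a := by
    rw [div_mul_eq_mul_div, le_div_iff₀ hρ]; nlinarith
  rw [intervalIntegral.integral_of_le hR₀.le, intervalIntegral.integral_of_le (hR₀.le.trans hb)]
  apply setIntegral_eq_of_subset_of_forall_sdiff_eq_zero measurableSet_Ioc
  · exact Set.Ioc_subset_Ioc_right hb
  · intro x hx
    apply h0
    by_contra h
    exact hx.2 ⟨hx.1.1, not_lt.1 h⟩

lemma trial {Ω : Set (ℝ × ℝ)} (hΩo : IsOpen Ω) (hΩb : Bornology.IsBounded Ω)
    (hRC1 : ContDiff ℝ 1 R) (hRper : Function.Periodic R (2 * Real.pi))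
    (hRpos : ∀ φ, 0 < R φ)
    (hstar : Ω = {p : ℝ × ℝ | ∃ r φ : ℝ, 0 ≤ r ∧ r < R φ ∧
      p = (x₀ + r * Real.cos φ, y₀ + r * Real.sin φ)})
    (hR₀ : 0 < R₀) (harea : ∫ φ in (-Real.pi)..Real.pi, R φ ^ 2 = 2 * Real.pi * R₀ ^ 2)
    (hg : ContDiff ℝ 1 g) (hδ : 0 < δ) (hg0 : ∀ s, s ≤ δ → g s = c) (hc : m ≠ 0 → c = 0)
    (hg1 : ∀ s, R₀ - δ ≤ s → g s = 0) (hC : 0 < ∫ s in (0)..R₀, s * g s ^ 2) (ω : ℝ) :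
    groundEnergy Ω ω x₀ y₀ * (2 * Real.pi * ∫ s in (0)..R₀, s * g s ^ 2)
      ≤ 2 * Real.pi * ((∫ s in (0)..R₀, s * deriv g s ^ 2)
          + ∫ s in (0)..R₀, (m : ℝ) ^ 2 * (g s ^ 2 / s))
        + (∫ φ in (-Real.pi)..Real.pi, (deriv R φ / R φ) ^ 2) * (∫ s in (0)..R₀, s * deriv g s ^ 2)
        - ω * m * (2 * Real.pi * ∫ s in (0)..R₀, s * g s ^ 2) := by
  have hpi := Real.pi_pos
  have hu : ContDiff ℝ 1 (tr x₀ y₀ R₀ R g m) := tr_contDiff hRC1 hRper hRpos hR₀ hg hδ hg0 hc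
  obtain ⟨hcs, hts⟩ := tr_supp (m := m) hRC1.continuous hRpos hR₀ hδ hg1 hstar
  obtain ⟨ρ, M, hρ, hb⟩ := R_bounds hRC1.continuous hRper hRpos
  have hM : 0 < M := hρ.trans_le ((hb 0).1.trans (hb 0).2)
  have hz : ∀ s, R₀ < s → g s = 0 := fun s hs => hg1 s (by linarith)
  have hz' : ∀ s, R₀ < s → deriv g s = 0 := by
    intro s hs
    have : g =ᶠ[nhds s] fun _ => 0 := by
      filter_upwards [Ioi_mem_nhds hs] with x hx using hz x hx
    rw [this.deriv_eq]; simp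
  have hout : ∀ r φ, M < r → pol x₀ y₀ r φ ∉ tsupport (tr x₀ y₀ R₀ R g m) := by
    intro r φ hr hmem
    have hr0 : 0 < r := hM.trans hr
    have := hts hmem
    rw [hstar] at this
    obtain ⟨r', φ', h0, h1, h2⟩ := this
    have h3 : pol x₀ y₀ r φ = pol x₀ y₀ r' φ' := h2
    have h4 := congrArg (fun p => ‖zc x₀ y₀ p‖) h3
    simp only [norm_zc_pol x₀ y₀ hr0.le, norm_zc_pol x₀ y₀ h0] at h4
    have := (hb φ').2
    linarith
  set A := ∫ s in (0)..R₀, s * deriv g s ^ 2 with hA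
  set B := ∫ s in (0)..R₀, (m : ℝ) ^ 2 * (g s ^ 2 / s) with hB
  set C := ∫ s in (0)..R₀, s * g s ^ 2 with hCdef
  have cg := hg.continuous
  have cg' : Continuous (deriv g) := hg.continuous_deriv le_rfl
  have cR := hRC1.continuous
  have cR' : Continuous (deriv R) := hRC1.continuous_deriv le_rfl
  have iA : IntervalIntegrable (fun s => s * deriv g s ^ 2) volume 0 R₀ :=
    (by fun_prop : Continuous fun s => s * deriv g s ^ 2).intervalIntegrable _ _
  have iC : IntervalIntegrable (fun s => s * g s ^ 2) volume 0 R₀ :=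
    (by fun_prop : Continuous fun s => s * g s ^ 2).intervalIntegrable _ _
  have iB : IntervalIntegrable (fun s => (m : ℝ) ^ 2 * (g s ^ 2 / s)) volume 0 R₀ := by
    have : (fun s => (m : ℝ) ^ 2 * (g s ^ 2 / s)) = fun s => (m : ℝ) ^ 2 * (g s ^ 2 / max s δ) := by
      ext s
      by_cases hm : m = 0
      · simp [hm]
      · rcases le_total s δ with h | h
        · rw [hg0 s h, hc hm]; simp
        · rw [max_eq_left h]
    rw [this]
    refine Continuous.intervalIntegrable ?_ _ _
    refine continuous_const.mul ((cg.pow 2).div (continuous_id.max continuous_const) fun s => ?_)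
    exact (hδ.trans_le (le_max_right _ _)).ne'
  have hR2 : ∫ φ in (-Real.pi)..Real.pi, (R φ / R₀) ^ 2 = 2 * Real.pi := by
    simp only [div_pow]
    rw [intervalIntegral.integral_div, harea]
    field_simp
  have enrm : nrm (tr x₀ y₀ R₀ R g m) = 2 * Real.pi * C := by
    rw [nrm, polar_int_phi x₀ y₀ (fun p => ‖tr x₀ y₀ R₀ R g m p‖ ^ 2) hM.le
      (fun r φ h => by simp [image_eq_zero_of_notMem_tsupport (hout r φ h)])
      (polar_integrable x₀ y₀ (hu.continuous.norm.pow 2) M)]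
    have : ∀ φ, ∫ r in (0)..M, r * ‖tr x₀ y₀ R₀ R g m (pol x₀ y₀ r φ)‖ ^ 2
        = (R φ / R₀) ^ 2 * C := by
      intro φ
      rw [hCdef, ← intervalIntegral.integral_const_mul,
        ← subst_int (h := fun s => (R φ / R₀) ^ 2 * (s * g s ^ 2)) hR₀ (hRpos φ) (hb φ).2
          (fun s hs => by simp [hz s hs]),
        intervalIntegral.integral_of_le hM.le, intervalIntegral.integral_of_le hM.le]
      exact setIntegral_congr_fun measurableSet_Ioc
        fun r hr => tr_nsq hRper hRpos hR₀ hr.1 φ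
    simp only [this]
    rw [intervalIntegral.integral_mul_const, hR2]
  have een : en ω x₀ y₀ (tr x₀ y₀ R₀ R g m) = 2 * Real.pi * (A + B)
      + (∫ φ in (-Real.pi)..Real.pi, (deriv R φ / R φ) ^ 2) * A - ω * m * (2 * Real.pi * C) := by
    rw [en, polar_int_phi x₀ y₀ (eDens ω x₀ y₀ (tr x₀ y₀ R₀ R g m)) hM.le
      (fun r φ h => zero_eDens ω x₀ y₀ (hout r φ h))
      (polar_integrable x₀ y₀ (continuous_eDens hu ω x₀ y₀) M)]
    have : ∀ φ, ∫ r in (0)..M, r * eDens ω x₀ y₀ (tr x₀ y₀ R₀ R g m) (pol x₀ y₀ r φ)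
        = (A + B) + (deriv R φ / R φ) ^ 2 * A - (R φ / R₀) ^ 2 * (ω * m * C) := by
      intro φ
      have h1 : ∫ s in (0)..R₀, ((1 + (deriv R φ / R φ) ^ 2) * (s * deriv g s ^ 2)
          + (m : ℝ) ^ 2 * (g s ^ 2 / s) - ω * m * (R φ / R₀) ^ 2 * (s * g s ^ 2))
          = (A + B) + (deriv R φ / R φ) ^ 2 * A - (R φ / R₀) ^ 2 * (ω * m * C) := by
        rw [intervalIntegral.integral_sub ((iA.const_mul _).add iB) (iC.const_mul _),
          intervalIntegral.integral_add (iA.const_mul _) iB,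
          intervalIntegral.integral_const_mul (1 + (deriv R φ / R φ) ^ 2),
          intervalIntegral.integral_const_mul (ω * m * (R φ / R₀) ^ 2), ← hA, ← hB, ← hCdef]
        ring
      rw [← h1,
        ← subst_int (h := fun s => (1 + (deriv R φ / R φ) ^ 2) * (s * deriv g s ^ 2)
          + (m : ℝ) ^ 2 * (g s ^ 2 / s) - ω * m * (R φ / R₀) ^ 2 * (s * g s ^ 2))
          hR₀ (hRpos φ) (hb φ).2
          (fun s hs => by simp [hz s hs, hz' s hs]),
        intervalIntegral.integral_of_le hM.le, intervalIntegral.integral_of_le hM.le]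
      exact setIntegral_congr_fun measurableSet_Ioc
        fun r hr => tr_eDens hRC1 hRper hRpos hR₀ hg hu hr.1 φ
    simp only [this]
    have cq : Continuous fun φ => (deriv R φ / R φ) ^ 2 :=
      (cR'.div cR fun φ => (hRpos φ).ne').pow 2
    have i1 : IntervalIntegrable (fun φ => (deriv R φ / R φ) ^ 2 * A) volume (-Real.pi) Real.pi :=
      (cq.mul continuous_const).intervalIntegrable _ _
    have i2 : IntervalIntegrable (fun φ => (R φ / R₀) ^ 2 * (ω * m * C)) volume
      (-Real.pi) Real.pi := (by fun_prop : Continuous _).intervalIntegrable _ _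
    rw [intervalIntegral.integral_sub (intervalIntegrable_const.add i1) i2,
      intervalIntegral.integral_add intervalIntegrable_const i1,
      intervalIntegral.integral_mul_const, intervalIntegral.integral_mul_const, hR2,
      intervalIntegral.integral_const, smul_eq_mul]
    ring
  rw [← een, ← enrm]
  exact ground_le hΩo hΩb ω x₀ y₀ _ hu hcs hts (by rw [enrm]; positivity)

lemma area_int {Ω : Set (ℝ × ℝ)} (hΩo : IsOpen Ω)
    (hRC1 : ContDiff ℝ 1 R) (hRper : Function.Periodic R (2 * Real.pi))
    (hRpos : ∀ φ, 0 < R φ)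
    (hstar : Ω = {p : ℝ × ℝ | ∃ r φ : ℝ, 0 ≤ r ∧ r < R φ ∧
      p = (x₀ + r * Real.cos φ, y₀ + r * Real.sin φ)})
    (harea : Real.pi * R₀ ^ 2 = (volume Ω).toReal) :
    ∫ φ in (-Real.pi)..Real.pi, R φ ^ 2 = 2 * Real.pi * R₀ ^ 2 := by
  obtain ⟨ρ, M, hρ, hb⟩ := R_bounds hRC1.continuous hRper hRpos
  have hM : 0 < M := hρ.trans_le ((hb 0).1.trans (hb 0).2)
  have hmem : ∀ r φ, 0 < r → (pol x₀ y₀ r φ ∈ Ω ↔ r < R φ) := by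
    intro r φ hr
    rw [hstar]
    constructor
    · rintro ⟨r', φ', h0, h1, h2⟩
      have h3 : pol x₀ y₀ r φ = pol x₀ y₀ r' φ' := h2
      have h4 := congrArg (fun p => ‖zc x₀ y₀ p‖) h3
      simp only [norm_zc_pol x₀ y₀ hr.le, norm_zc_pol x₀ y₀ h0] at h4
      have h5 := congrArg (fun p => ((zc x₀ y₀ p).arg : Real.Angle)) h3
      simp only [zc_pol] at h5
      have e1 := Complex.arg_mul_cos_add_sin_mul_I_coe_angle hr (φ : Real.Angle)
      have e2 := Complex.arg_mul_cos_add_sin_mul_I_coe_angle (h4 ▸ hr : 0 < r') (φ' : Real.Angle)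
      have e3 : (φ : Real.Angle) = φ' := e1.symm.trans (h5.trans e2)
      rw [R_angle hRper e3, h4]
      exact h1
    · intro h
      exact ⟨r, φ, hr.le, h, rfl⟩
  have hvol : (volume Ω).toReal = ∫ p, Ω.indicator (fun _ => (1 : ℝ)) p := by
    rw [integral_indicator hΩo.measurableSet]
    simp [Measure.real]
  have hind : ∀ r φ, 0 < r → Ω.indicator (fun _ => (1 : ℝ)) (pol x₀ y₀ r φ)
      = if r < R φ then 1 else 0 := by
    intro r φ hr
    classical
    rw [Set.indicator_apply]
    simp only [hmem r φ hr]
  rw [polar_int_phi x₀ y₀ (Ω.indicator fun _ => (1 : ℝ)) hM.le] at hvol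
  · have : ∀ φ, ∫ r in (0)..M, r * Ω.indicator (fun _ => (1 : ℝ)) (pol x₀ y₀ r φ)
        = R φ ^ 2 / 2 := by
      intro φ
      have hI : ∫ r in (0)..(R φ), r = R φ ^ 2 / 2 := by simp
      rw [← hI, intervalIntegral.integral_of_le hM.le, intervalIntegral.integral_of_le (hRpos φ).le,
        integral_Ioc_eq_integral_Ioo (x := 0) (y := R φ)]
      have e : ∫ r in Set.Ioc 0 M, r * Ω.indicator (fun _ => (1 : ℝ)) (pol x₀ y₀ r φ)
        = ∫ r in Set.Ioo 0 (R φ), r * Ω.indicator (fun _ => (1 : ℝ)) (pol x₀ y₀ r φ) := by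
        apply setIntegral_eq_of_subset_of_forall_sdiff_eq_zero measurableSet_Ioc
        · exact fun x hx => ⟨hx.1, hx.2.le.trans (hb φ).2⟩
        · intro x hx
          rw [hind x φ hx.1.1, if_neg, mul_zero]
          exact fun h => hx.2 ⟨hx.1.1, h⟩
      rw [e]
      refine setIntegral_congr_fun measurableSet_Ioo fun r hr => ?_
      simp only [hind r φ hr.1, if_pos hr.2, mul_one]
    simp only [this] at hvol
    rw [intervalIntegral.integral_div] at hvol
    linarith
  · intro r φ hr
    rw [hind r φ (hM.trans hr), if_neg]
    have := (hb φ).2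
    linarith
  · have hs : MeasurableSet (Set.Ioc 0 M ×ˢ Set.Ioc (-Real.pi) Real.pi : Set (ℝ × ℝ)) :=
      measurableSet_Ioc.prod measurableSet_Ioc
    refine Measure.integrableOn_of_bounded (M := M) ?_ ?_ ?_
    · rw [Measure.volume_eq_prod, Measure.prod_prod]
      simp [ENNReal.mul_eq_top]
    · apply Measurable.aestronglyMeasurable
      exact measurable_fst.mul ((measurable_const.indicator hΩo.measurableSet).comp
        (continuous_pol x₀ y₀).measurable)
    · refine (ae_restrict_iff' hs).2 (Filter.Eventually.of_forall fun q hq => ?_)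
      rw [hind q.1 q.2 hq.1.1, norm_mul, Real.norm_of_nonneg hq.1.1.le]
      have := hq.1.2
      split_ifs
      · simpa using this
      · simpa using hM.le

end
end

section
open MeasureTheory Filter Topology

noncomputable def TT (δ t : ℝ) : ℝ := max t δ + δ ^ 2 / max t δ - 2 * δ
noncomputable def TT' (δ t : ℝ) : ℝ := 1 - δ ^ 2 / (max t δ) ^ 2

lemma TT_cont {δ : ℝ} (hδ : 0 < δ) : Continuous (TT δ) := by
  have h : ∀ t, max t δ ≠ 0 := fun t => (hδ.trans_le (le_max_right _ _)).ne'
  unfold TT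
  fun_prop (disch := exact h _)

lemma TT'_cont {δ : ℝ} (hδ : 0 < δ) : Continuous (TT' δ) := by
  have h : ∀ t, max t δ ^ 2 ≠ 0 := fun t => pow_ne_zero _ (hδ.trans_le (le_max_right _ _)).ne'
  unfold TT'
  fun_prop (disch := exact h _)

lemma TT_eq_zero {δ : ℝ} (hδ : 0 < δ) {t : ℝ} (ht : t ≤ δ) : TT δ t = 0 := by
  rw [TT, max_eq_right ht]; field_simp; ring

lemma TT_hasDerivAt {δ : ℝ} (hδ : 0 < δ) (t : ℝ) : HasDerivAt (TT δ) (TT' δ t) t := by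
  have key : ∀ y, y ≠ δ → HasDerivAt (TT δ) (TT' δ y) y := by
    intro y hy
    rcases lt_or_gt_of_ne hy with h | h
    · have e : TT' δ y = 0 := by rw [TT', max_eq_right h.le]; field_simp; ring
      rw [e]
      refine (hasDerivAt_const y (0 : ℝ)).congr_of_eventuallyEq ?_
      filter_upwards [Iio_mem_nhds h] with x hx using TT_eq_zero hδ (le_of_lt hx)
    · have hy0 : y ≠ 0 := (hδ.trans h).ne'
      have h1 : HasDerivAt (fun x : ℝ => x + δ ^ 2 / x - 2 * δ) (1 + (0 * y - δ ^ 2 * 1) / y ^ 2) y :=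
        ((hasDerivAt_id y).add ((hasDerivAt_const y (δ ^ 2)).div (hasDerivAt_id y) hy0)).sub_const _
      have h2 : HasDerivAt (TT δ) (1 + (0 * y - δ ^ 2 * 1) / y ^ 2) y := by
        refine h1.congr_of_eventuallyEq ?_
        filter_upwards [Ioi_mem_nhds h] with x hx
        rw [TT, max_eq_left (le_of_lt hx)]
      refine h2.congr_deriv ?_
      rw [TT', max_eq_left h.le]; ring
  by_cases ht : t = δ
  · subst ht
    exact hasDerivAt_of_hasDerivAt_of_ne key (TT_cont hδ).continuousAt (TT'_cont hδ).continuousAt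
  · exact key t ht

lemma TT_contDiff {δ : ℝ} (hδ : 0 < δ) : ContDiff ℝ 1 (TT δ) := by
  rw [contDiff_one_iff_deriv]
  refine ⟨fun t => (TT_hasDerivAt hδ t).differentiableAt, ?_⟩
  have : deriv (TT δ) = TT' δ := funext fun t => (TT_hasDerivAt hδ t).deriv
  rw [this]; exact TT'_cont hδ

lemma TT_nonneg {δ : ℝ} (hδ : 0 < δ) (t : ℝ) : 0 ≤ TT δ t := by
  have h : 0 < max t δ := hδ.trans_le (le_max_right _ _)
  have : TT δ t = (max t δ - δ) ^ 2 / max t δ := by rw [TT]; field_simp; ring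
  rw [this]; positivity

lemma TT_le {δ : ℝ} (hδ : 0 < δ) {t : ℝ} (ht : 0 ≤ t) : TT δ t ≤ t := by
  rcases le_total t δ with h | h
  · rwa [TT_eq_zero hδ h]
  · rw [TT, max_eq_left h]
    have : δ ^ 2 / t ≤ δ := by rw [div_le_iff₀ (hδ.trans_le h)]; nlinarith
    linarith

lemma TT_ge {δ : ℝ} (hδ : 0 < δ) (t : ℝ) : t - 2 * δ ≤ TT δ t := by
  have h : 0 < max t δ := hδ.trans_le (le_max_right _ _)
  have : 0 ≤ δ ^ 2 / max t δ := by positivity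
  have := le_max_left t δ
  rw [TT]; linarith

lemma TT'_abs {δ : ℝ} (hδ : 0 < δ) (t : ℝ) : |TT' δ t| ≤ 1 := by
  have h : 0 < max t δ := hδ.trans_le (le_max_right _ _)
  have h1 : 0 ≤ δ ^ 2 / max t δ ^ 2 := by positivity
  have h2 : δ ^ 2 / max t δ ^ 2 ≤ 1 := by
    rw [div_le_one (by positivity)]
    exact pow_le_pow_left₀ hδ.le (le_max_right _ _) 2
  rw [TT', abs_le]; constructor <;> linarith

lemma TT_tendsto {d t : ℕ → ℝ} {τ : ℝ} (hd : Tendsto d atTop (𝓝 0)) (ht : Tendsto t atTop (𝓝 τ))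
    (hτ : 0 < τ) : Tendsto (fun k => TT (d k) (t k)) atTop (𝓝 τ) ∧
      Tendsto (fun k => TT' (d k) (t k)) atTop (𝓝 1) := by
  have h1 : Tendsto (fun k => max (t k) (d k)) atTop (𝓝 τ) := by
    simpa [max_eq_left hτ.le] using ht.max hd
  have h2 := (hd.pow 2).div h1 hτ.ne'
  have h3 := (hd.pow 2).div (h1.pow 2) (pow_ne_zero 2 hτ.ne')
  constructor
  · simpa [TT] using (h1.add h2).sub (hd.const_mul 2)
  · simpa [TT'] using h3.const_sub 1

section
variable {f : ℝ → ℝ} {m : ℕ} {lam R₀ : ℝ}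

noncomputable def HH (f : ℝ → ℝ) (ε δ s : ℝ) : ℝ := TT ε (f (TT δ s))
noncomputable def gg (f : ℝ → ℝ) (R₀ ε δ s : ℝ) : ℝ := if s < R₀ then HH f ε δ s else 0

lemma HH_deriv (h : BF f m lam R₀) {ε δ : ℝ} (hε : 0 < ε) (hδ : 0 < δ) (s : ℝ) :
    HasDerivAt (HH f ε δ) (TT' ε (f (TT δ s)) * (deriv f (TT δ s) * TT' δ s)) s :=
  (TT_hasDerivAt hε _).comp s ((h.d1 _).comp s (TT_hasDerivAt hδ s))

lemma BF.nonneg (h : BF f m lam R₀) (hR₀ : 0 < R₀) {r : ℝ} (h0 : 0 ≤ r) (h1 : r ≤ R₀) :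
    0 ≤ f r := by
  have hc : IsClosed {r | 0 ≤ f r} := isClosed_le continuous_const h.c0
  have : closure (Set.Ioo 0 R₀) ⊆ {r | 0 ≤ f r} :=
    closure_minimal (fun x hx => (h.pos x hx.1 hx.2).le) hc
  rw [closure_Ioo hR₀.ne] at this
  exact this ⟨h0, h1⟩

lemma BF.lip (h : BF f m lam R₀) (hR₀ : 0 < R₀) : ∃ L, 0 < L ∧ ∀ r, 0 ≤ r → r ≤ R₀ →
    |deriv f r| ≤ L ∧ f r ≤ L * (R₀ - r) ∧ (m ≠ 0 → f r ≤ L * r) := by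
  obtain ⟨L, hL⟩ := (isCompact_Icc (a := 0) (b := R₀)).exists_bound_of_continuousOn
    h.c1.continuousOn
  have hmv : ∀ x ∈ Set.Icc 0 R₀, ∀ y ∈ Set.Icc 0 R₀, ‖f y - f x‖ ≤ L * ‖y - x‖ :=
    fun x hx y hy => (convex_Icc 0 R₀).norm_image_sub_le_of_norm_deriv_le
      (fun z _ => (h.d1 z).differentiableAt) hL hx hy
  refine ⟨|L| + 1, by positivity, fun r h0 h1 => ⟨?_, ?_, fun hm => ?_⟩⟩
  · have := hL r ⟨h0, h1⟩
    rw [Real.norm_eq_abs] at this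
    linarith [le_abs_self L]
  · have := hmv R₀ ⟨hR₀.le, le_rfl⟩ r ⟨h0, h1⟩
    rw [h.zero, sub_zero, Real.norm_eq_abs, Real.norm_eq_abs, abs_sub_comm,
      abs_of_nonneg (sub_nonneg.2 h1)] at this
    have h2 := le_abs_self (f r)
    have h3 := le_abs_self L
    nlinarith
  · have := hmv 0 ⟨le_rfl, hR₀.le⟩ r ⟨h0, h1⟩
    rw [h.f_zero hm, sub_zero, sub_zero, Real.norm_eq_abs, Real.norm_eq_abs,
      abs_of_nonneg h0] at this
    have h2 := le_abs_self (f r)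
    have h3 := le_abs_self L
    nlinarith

lemma TT_mem {δ s : ℝ} (hδ : 0 < δ) (hR₀ : 0 < R₀) (hs : s ≤ R₀) :
    0 ≤ TT δ s ∧ TT δ s ≤ R₀ := by
  refine ⟨TT_nonneg hδ s, ?_⟩
  rcases le_total 0 s with h | h
  · exact (TT_le hδ h).trans hs
  · rw [TT_eq_zero hδ (h.trans hδ.le)]; exact hR₀.le

lemma gg_props (h : BF f m lam R₀) (hR₀ : 0 < R₀) {L : ℝ} (hL : 0 < L)
    (hLip : ∀ r, 0 ≤ r → r ≤ R₀ →
      |deriv f r| ≤ L ∧ f r ≤ L * (R₀ - r) ∧ (m ≠ 0 → f r ≤ L * r))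
    {δ : ℝ} (hδ : 0 < δ) (hδR : δ < R₀) :
    ContDiff ℝ 1 (gg f R₀ (3 * L * δ) δ) ∧
    (∃ c, (∀ s, s ≤ δ → gg f R₀ (3 * L * δ) δ s = c) ∧ (m ≠ 0 → c = 0)) ∧
    (∀ s, R₀ - δ ≤ s → gg f R₀ (3 * L * δ) δ s = 0) := by
  have hε : 0 < 3 * L * δ := by positivity
  have hz : ∀ s, R₀ - δ ≤ s → gg f R₀ (3 * L * δ) δ s = 0 := by
    intro s hs
    unfold gg
    split_ifs with hlt
    · have hm := TT_mem hδ hR₀ hlt.le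
      have h1 := (hLip _ hm.1 hm.2).2.1
      have h2 := TT_ge hδ s
      exact TT_eq_zero hε (by nlinarith)
    · rfl
  refine ⟨?_, ⟨TT (3 * L * δ) (f 0), fun s hs => ?_, fun hm => ?_⟩, hz⟩
  · have hH : ContDiff ℝ 1 (HH f (3 * L * δ) δ) :=
      (TT_contDiff hε).comp ((h.smooth.of_le (by norm_num)).comp (TT_contDiff hδ))
    rw [contDiff_iff_contDiffAt]
    intro s
    by_cases hs : s < R₀
    · refine hH.contDiffAt.congr_of_eventuallyEq ?_
      filter_upwards [Iio_mem_nhds hs] with x hx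
      exact if_pos hx
    · refine (contDiffAt_const (c := (0 : ℝ))).congr_of_eventuallyEq ?_
      have : R₀ - δ < s := by linarith [not_lt.1 hs]
      filter_upwards [Ioi_mem_nhds this] with x hx
      exact hz x (le_of_lt hx)
  · rw [gg, if_pos (by linarith), HH, TT_eq_zero hδ hs]
  · rw [h.f_zero hm, TT_eq_zero hε hε.le]

lemma gg_deriv (h : BF f m lam R₀) {ε δ s : ℝ} (hε : 0 < ε) (hδ : 0 < δ) (hs : s < R₀) :
    deriv (gg f R₀ ε δ) s = TT' ε (f (TT δ s)) * (deriv f (TT δ s) * TT' δ s) := by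
  have : gg f R₀ ε δ =ᶠ[𝓝 s] HH f ε δ := by
    filter_upwards [Iio_mem_nhds hs] with x hx
    exact if_pos hx
  rw [this.deriv_eq]
  exact (HH_deriv h hε hδ s).deriv

lemma approx (h : BF f m lam R₀) (hR₀ : 0 < R₀) :
    ∃ g : ℕ → ℝ → ℝ, ∃ d : ℕ → ℝ, (∀ k, 0 < d k ∧ ContDiff ℝ 1 (g k) ∧
      (∃ c, (∀ s, s ≤ d k → g k s = c) ∧ (m ≠ 0 → c = 0)) ∧ (∀ s, R₀ - d k ≤ s → g k s = 0)) ∧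
    Tendsto (fun k => ∫ s in (0)..R₀, s * deriv (g k) s ^ 2) atTop
      (𝓝 (∫ s in (0)..R₀, s * deriv f s ^ 2)) ∧
    Tendsto (fun k => ∫ s in (0)..R₀, (m : ℝ) ^ 2 * (g k s ^ 2 / s)) atTop
      (𝓝 (∫ s in (0)..R₀, (m : ℝ) ^ 2 * (f s ^ 2 / s))) ∧
    Tendsto (fun k => ∫ s in (0)..R₀, s * g k s ^ 2) atTop
      (𝓝 (∫ s in (0)..R₀, s * f s ^ 2)) := by
  obtain ⟨L, hL, hLip⟩ := h.lip hR₀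
  set d : ℕ → ℝ := fun k => R₀ / 2 * (1 / ((k : ℝ) + 1)) with hd
  have hd0 : ∀ k, 0 < d k := fun k => by rw [hd]; positivity
  have hdR : ∀ k, d k < R₀ := by
    intro k
    have : 1 / ((k : ℝ) + 1) ≤ 1 := by
      rw [div_le_one (by positivity)]; linarith [Nat.cast_nonneg (α := ℝ) k]
    simp only [hd]
    nlinarith
  have hdt : Tendsto d atTop (𝓝 0) := by
    simpa [hd] using (tendsto_one_div_add_atTop_nhds_zero_nat (𝕜 := ℝ)).const_mul (R₀ / 2)
  set e : ℕ → ℝ := fun k => 3 * L * d k with he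
  have he0 : ∀ k, 0 < e k := fun k => by have := hd0 k; simp only [he]; positivity
  have het : Tendsto e atTop (𝓝 0) := by simpa using hdt.const_mul (3 * L)
  set g : ℕ → ℝ → ℝ := fun k => gg f R₀ (e k) (d k) with hg
  have hp : ∀ k, _ := fun k => gg_props h hR₀ hL hLip (hd0 k) (hdR k)
  have hcg : ∀ k, Continuous (g k) := fun k => (hp k).1.continuous
  have hcg' : ∀ k, Continuous (deriv (g k)) := fun k => (hp k).1.continuous_deriv le_rfl
  have hne : ∀ᵐ s : ℝ, s ≠ R₀ := by
    rw [ae_iff]; simp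
  -- pointwise limits
  have hT : ∀ s, 0 < s → Tendsto (fun k => TT (d k) s) atTop (𝓝 s) ∧
      Tendsto (fun k => TT' (d k) s) atTop (𝓝 1) :=
    fun s hs => TT_tendsto hdt tendsto_const_nhds hs
  have hlim : ∀ s, 0 < s → s < R₀ → Tendsto (fun k => g k s) atTop (𝓝 (f s)) := by
    intro s h0 h1
    have a1 := (h.c0.tendsto s).comp (hT s h0).1
    have a2 := (TT_tendsto het a1 (h.pos s h0 h1)).1
    refine a2.congr fun k => ?_
    simp only [hg, gg, if_pos h1, HH, Function.comp]
  have hlim' : ∀ s, 0 < s → s < R₀ → Tendsto (fun k => deriv (g k) s) atTop (𝓝 (deriv f s)) := by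
    intro s h0 h1
    have a1 := (h.c0.tendsto s).comp (hT s h0).1
    have a2 := (TT_tendsto het a1 (h.pos s h0 h1)).2
    have a3 := (h.c1.tendsto s).comp (hT s h0).1
    have a4 := a2.mul (a3.mul (hT s h0).2)
    rw [one_mul, mul_one] at a4
    refine a4.congr fun k => ?_
    simp only [hg, gg_deriv h (he0 k) (hd0 k) h1, Function.comp]
  -- bounds
  have hb0 : ∀ k s, 0 < s → s ≤ R₀ → 0 ≤ g k s ∧ g k s ≤ L * R₀ ∧ (m ≠ 0 → g k s ≤ L * s) := by
    intro k s h0 h1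
    have hm := TT_mem (hd0 k) hR₀ h1
    obtain ⟨_, l2, l3⟩ := hLip _ hm.1 hm.2
    have hnn := h.nonneg hR₀ hm.1 hm.2
    have t1 := TT_le (he0 k) hnn
    have t2 := TT_nonneg (he0 k) (f (TT (d k) s))
    have t3 := TT_le (hd0 k) h0.le
    simp only [hg, gg]
    split_ifs
    · refine ⟨t2, ?_, fun hm0 => ?_⟩
      · unfold HH; nlinarith [hm.1]
      · have := l3 hm0
        unfold HH; nlinarith
    · exact ⟨le_rfl, by positivity, fun _ => by positivity⟩
  have hb1 : ∀ k s, 0 < s → s < R₀ → |deriv (g k) s| ≤ L := by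
    intro k s h0 h1
    have hm := TT_mem (hd0 k) hR₀ h1.le
    obtain ⟨l1, _, _⟩ := hLip _ hm.1 hm.2
    simp only [hg]
    rw [gg_deriv h (he0 k) (hd0 k) h1, abs_mul, abs_mul]
    have b1 := TT'_abs (he0 k) (f (TT (d k) s))
    have b2 := TT'_abs (hd0 k) s
    calc _ ≤ 1 * (L * 1) := by gcongr
      _ = L := by ring
  refine ⟨g, d, fun k => ⟨hd0 k, hp k⟩, ?_, ?_, ?_⟩
  · refine intervalIntegral.tendsto_integral_filter_of_dominated_convergence
      (fun _ => R₀ * L ^ 2) (Eventually.of_forall fun k => ?_) (Eventually.of_forall fun k => ?_)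
      intervalIntegrable_const ?_
    · have := hcg' k
      exact (by fun_prop : Continuous fun s => s * deriv (g k) s ^ 2).aestronglyMeasurable
    · filter_upwards [hne] with s hs hmem
      rw [Set.uIoc_of_le hR₀.le] at hmem
      have hlt := lt_of_le_of_ne hmem.2 hs
      have h1 := hb1 k s hmem.1 hlt
      have h0 := hmem.1
      rw [norm_mul, Real.norm_of_nonneg h0.le, norm_pow, Real.norm_eq_abs]
      gcongr
    · filter_upwards [hne] with s hs hmem
      rw [Set.uIoc_of_le hR₀.le] at hmem
      exact ((hlim' s hmem.1 (lt_of_le_of_ne hmem.2 hs)).pow 2).const_mul s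
  · refine intervalIntegral.tendsto_integral_filter_of_dominated_convergence
      (fun _ => (m : ℝ) ^ 2 * (L ^ 2 * R₀)) (Eventually.of_forall fun k => ?_)
      (Eventually.of_forall fun k => ?_) intervalIntegrable_const ?_
    · have := (hcg k).measurable
      exact (by fun_prop : Measurable fun s => (m : ℝ) ^ 2 * (g k s ^ 2 / s)).aestronglyMeasurable
    · refine Eventually.of_forall fun s hmem => ?_
      rw [Set.uIoc_of_le hR₀.le] at hmem
      by_cases hm : m = 0
      · simp [hm]
      · have h0 := hmem.1
        obtain ⟨b0, _, b2⟩ := hb0 k s h0 hmem.2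
        have b3 := b2 hm
        rw [Real.norm_of_nonneg (by positivity)]
        have : g k s ^ 2 / s ≤ L ^ 2 * R₀ := by
          rw [div_le_iff₀ h0]
          calc g k s ^ 2 ≤ (L * s) ^ 2 := by gcongr
            _ = L ^ 2 * s * s := by ring
            _ ≤ L ^ 2 * R₀ * s := by have := hmem.2; gcongr
        gcongr
    · filter_upwards [hne] with s hs hmem
      rw [Set.uIoc_of_le hR₀.le] at hmem
      exact (((hlim s hmem.1 (lt_of_le_of_ne hmem.2 hs)).pow 2).div_const s).const_mul _
  · refine intervalIntegral.tendsto_integral_filter_of_dominated_convergence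
      (fun _ => R₀ * (L * R₀) ^ 2) (Eventually.of_forall fun k => ?_)
      (Eventually.of_forall fun k => ?_) intervalIntegrable_const ?_
    · have := hcg k
      exact (by fun_prop : Continuous fun s => s * g k s ^ 2).aestronglyMeasurable
    · refine Eventually.of_forall fun s hmem => ?_
      rw [Set.uIoc_of_le hR₀.le] at hmem
      have h0 := hmem.1
      obtain ⟨b0, b1, _⟩ := hb0 k s h0 hmem.2
      rw [Real.norm_of_nonneg (by positivity)]
      have := hmem.2
      gcongr
    · filter_upwards [hne] with s hs hmem
      rw [Set.uIoc_of_le hR₀.le] at hmem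
      exact ((hlim s hmem.1 (lt_of_le_of_ne hmem.2 hs)).pow 2).const_mul _

end

lemma mode_bound {x₀ y₀ R₀ ω lam : ℝ} {R f : ℝ → ℝ} {m : ℕ}
    {Ω : Set (ℝ × ℝ)} (hΩo : IsOpen Ω) (hΩb : Bornology.IsBounded Ω)
    (hRC1 : ContDiff ℝ 1 R) (hRper : Function.Periodic R (2 * Real.pi))
    (hRpos : ∀ φ, 0 < R φ)
    (hstar : Ω = {p : ℝ × ℝ | ∃ r φ : ℝ, 0 ≤ r ∧ r < R φ ∧
      p = (x₀ + r * Real.cos φ, y₀ + r * Real.sin φ)})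
    (hR₀ : 0 < R₀) (harea : ∫ φ in (-Real.pi)..Real.pi, R φ ^ 2 = 2 * Real.pi * R₀ ^ 2)
    (h : BF f m lam R₀) :
    (m : ℝ) ^ 2 / R₀ ^ 2 ≤ lam ∧
    groundEnergy Ω ω x₀ y₀ ≤ lam - m * ω
      + (∫ φ in (-Real.pi)..Real.pi, (deriv R φ / R φ) ^ 2) * ((lam - (m : ℝ) ^ 2 / R₀ ^ 2) / (2 * Real.pi)) := by
  have hpi := Real.pi_pos
  obtain ⟨hC, hAB, hBC⟩ := h.energy hR₀
  obtain ⟨g, d, hg, tA, tB, tC⟩ := approx h hR₀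
  set A := ∫ s in (0)..R₀, s * deriv f s ^ 2
  set B := ∫ s in (0)..R₀, (m : ℝ) ^ 2 * (f s ^ 2 / s)
  set C := ∫ s in (0)..R₀, s * f s ^ 2
  set K := ∫ φ in (-Real.pi)..Real.pi, (deriv R φ / R φ) ^ 2 with hK
  have hK0 : 0 ≤ K :=
    intervalIntegral.integral_nonneg (by linarith) fun φ _ => sq_nonneg _
  have hA0 : 0 ≤ A := intervalIntegral.integral_nonneg hR₀.le fun s hs =>
    mul_nonneg hs.1 (sq_nonneg _)
  have hA1 : A ≤ (lam - (m : ℝ) ^ 2 / R₀ ^ 2) * C := by linarith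
  refine ⟨?_, ?_⟩
  · have : 0 ≤ (lam - (m : ℝ) ^ 2 / R₀ ^ 2) * C := hA0.trans hA1
    have := nonneg_of_mul_nonneg_left this hC
    linarith
  have hlim : groundEnergy Ω ω x₀ y₀ * (2 * Real.pi * C) ≤
      2 * Real.pi * (A + B) + K * A - ω * m * (2 * Real.pi * C) := by
    refine le_of_tendsto_of_tendsto ((tC.const_mul (2 * Real.pi)).const_mul _)
      ((((tA.add tB).const_mul (2 * Real.pi)).add (tA.const_mul K)).sub
        ((tC.const_mul (2 * Real.pi)).const_mul (ω * m))) ?_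
    filter_upwards [tC.eventually (lt_mem_nhds hC)] with k hk
    obtain ⟨h0, h1, ⟨c, h2, h3⟩, h4⟩ := hg k
    exact trial hΩo hΩb hRC1 hRper hRpos hstar hR₀ harea h1 h0 h2 h3 h4 hk ω
  have h2 : groundEnergy Ω ω x₀ y₀ * (2 * Real.pi * C) ≤
      (lam - m * ω + K * ((lam - (m : ℝ) ^ 2 / R₀ ^ 2) / (2 * Real.pi))) * (2 * Real.pi * C) := by
    refine hlim.trans ?_
    rw [hAB]
    have e : (lam - m * ω + K * ((lam - (m : ℝ) ^ 2 / R₀ ^ 2) / (2 * Real.pi))) * (2 * Real.pi * C)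
      = 2 * Real.pi * (lam * C) + K * ((lam - (m : ℝ) ^ 2 / R₀ ^ 2) * C)
        - ω * m * (2 * Real.pi * C) := by
      have : 2 * Real.pi ≠ 0 := by positivity
      field_simp
      ring
    rw [e]
    have := mul_le_mul_of_nonneg_left hA1 hK0
    linarith
  exact le_of_mul_le_mul_right h2 (by positivity)
end

section
open MeasureTheory

lemma disk_nonempty (ω : ℝ) {R₀ : ℝ} (hR₀ : 0 < R₀) :
    {E : ℝ | ∃ u : ℝ × ℝ → ℂ, ContDiff ℝ (⊤ : ℕ∞) u ∧ HasCompactSupport u ∧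
      tsupport u ⊆ {p : ℝ × ℝ | p.1 ^ 2 + p.2 ^ 2 < R₀ ^ 2} ∧
      (∫ p, ‖u p‖ ^ 2) = 1 ∧
      E = ∫ p, (‖dX u p‖ ^ 2 + ‖dY u p‖ ^ 2
        + (Complex.I * (ω : ℂ)
          * (((p.1 - 0 : ℝ) : ℂ) * dY u p - ((p.2 - 0 : ℝ) : ℂ) * dX u p)
          * (starRingEnd ℂ) (u p)).re)}.Nonempty := by
  let b : ContDiffBump (0 : ℝ × ℝ) := ⟨R₀ / 4, R₀ / 2, by positivity, by linarith⟩
  have hb1 : ContDiff ℝ (⊤ : ℕ∞) b := b.contDiff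
  have hbc : Continuous b := b.continuous
  have hbs : HasCompactSupport b := b.hasCompactSupport
  set N := ∫ p, b p ^ 2 with hN
  have hN0 : 0 < N := by
    have hc : Continuous fun p => b p ^ 2 := hbc.pow 2
    have hs : HasCompactSupport fun p => b p ^ 2 :=
      HasCompactSupport.intro hbs fun p hp => by simp [image_eq_zero_of_notMem_tsupport hp]
    refine hc.integral_pos_of_hasCompactSupport_nonneg_nonzero hs (fun p => sq_nonneg _)
      (x := 0) ?_
    have : b 0 = 1 := b.one_of_mem_closedBall (by simp [b]; positivity)
    rw [this]; norm_num
  let u : ℝ × ℝ → ℂ := fun p => (((Real.sqrt N)⁻¹ * b p : ℝ) : ℂ)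
  refine ⟨_, u, ?_, ?_, ?_, ?_, rfl⟩
  · exact Complex.ofRealCLM.contDiff.comp (contDiff_const.mul hb1)
  · exact HasCompactSupport.intro hbs fun p hp => by
      simp [u, image_eq_zero_of_notMem_tsupport hp]
  · have h1 : tsupport u ⊆ tsupport b := by
      refine closure_mono fun p hp => ?_
      intro h0
      exact hp (by simp [u, h0])
    refine h1.trans ?_
    rw [b.tsupport_eq]
    intro p hp
    rw [mem_closedBall_zero_iff, Prod.norm_def, max_le_iff] at hp
    have e : b.rOut = R₀ / 2 := rfl
    rw [e, Real.norm_eq_abs, Real.norm_eq_abs] at hp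
    have a1 := sq_le_sq' (by linarith [neg_abs_le p.1]) ((le_abs_self _).trans hp.1)
    have a2 := sq_le_sq' (by linarith [neg_abs_le p.2]) ((le_abs_self _).trans hp.2)
    change p.1 ^ 2 + p.2 ^ 2 < R₀ ^ 2
    nlinarith
  · have : ∀ p, ‖u p‖ ^ 2 = N⁻¹ * b p ^ 2 := by
      intro p
      simp only [u]
      rw [Complex.norm_real, Real.norm_eq_abs, sq_abs, mul_pow, inv_pow, Real.sq_sqrt hN0.le]
    simp only [this]
    rw [integral_const_mul, ← hN, inv_mul_cancel₀ hN0.ne']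
end

/-- for a bounded convex region `Ω`, star-shaped about `(x₀,y₀) ∈ Ω` with
boundary `r = R(φ)`, and `B` the disk of radius `R₀` with `πR₀² = |Ω|`, the ground state
eigenvalues satisfy
`λ₁,Ω^ω(x₀,y₀) ≤ λ₁,B^ω(0,0) + (∫₀^{2π}(R'/R)² dφ) · sup_{0≤m≤(R₀²ω+√(R₀⁴ω²+4j₀₁²))/2} (j_{m,1}²-m²)/(2πR₀²)`,
where `j_{m,1}` is the first positive zero of the Bessel function `J_m` (characterized here
by the Bessel ODE together with minimality of the zero). -/
theorem statement17
    (Ω : Set (ℝ × ℝ)) (hΩo : IsOpen Ω) (hconv : Convex ℝ Ω) (hΩb : Bornology.IsBounded Ω)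
    (x₀ y₀ : ℝ) (hmem : (x₀, y₀) ∈ Ω) (ω : ℝ) (hω : 0 < ω)
    (R : ℝ → ℝ) (hRC1 : ContDiff ℝ 1 R) (hRper : Function.Periodic R (2 * Real.pi))
    (hRpos : ∀ φ, 0 < R φ)
    (hstar : Ω = {p : ℝ × ℝ | ∃ r φ : ℝ, 0 ≤ r ∧ r < R φ ∧
      p = (x₀ + r * Real.cos φ, y₀ + r * Real.sin φ)})
    (R₀ : ℝ) (hR₀ : 0 < R₀) (harea : Real.pi * R₀ ^ 2 = (volume Ω).toReal)
    (J : ℕ → ℝ → ℝ) (j : ℕ → ℝ)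
    (hJsm : ∀ m, ContDiff ℝ (⊤ : ℕ∞) (J m))
    (hJode : ∀ m : ℕ, ∀ x : ℝ, 0 < x →
      x ^ 2 * deriv (deriv (J m)) x + x * deriv (J m) x + (x ^ 2 - (m : ℝ) ^ 2) * J m x = 0)
    (hJnontriv : ∀ m, ∃ x, 0 < x ∧ J m x ≠ 0)
    (hjpos : ∀ m, 0 < j m) (hjzero : ∀ m, J m (j m) = 0)
    (hjfirst : ∀ m, ∀ x : ℝ, 0 < x → x < j m → J m x ≠ 0) :
    groundEnergy Ω ω x₀ y₀
      ≤ groundEnergy {p : ℝ × ℝ | p.1 ^ 2 + p.2 ^ 2 < R₀ ^ 2} ω 0 0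
        + (∫ φ in (0 : ℝ)..(2 * Real.pi), (deriv R φ / R φ) ^ 2)
          * sSup {x : ℝ | ∃ m : ℕ,
              (m : ℝ) ≤ (R₀ ^ 2 * ω + Real.sqrt (R₀ ^ 4 * ω ^ 2 + 4 * j 0 ^ 2)) / 2 ∧
              x = (j m ^ 2 - (m : ℝ) ^ 2) / (2 * Real.pi * R₀ ^ 2)} := by
  have hpi := Real.pi_pos
  have hA := area_int hΩo hRC1 hRper hRpos hstar harea
  have hK : ∫ φ in (0 : ℝ)..(2 * Real.pi), (deriv R φ / R φ) ^ 2
      = ∫ φ in (-Real.pi)..Real.pi, (deriv R φ / R φ) ^ 2 := by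
    have hd : Function.Periodic (deriv R) (2 * Real.pi) := by
      intro x
      have h1 : (fun y => R (y + 2 * Real.pi)) = R := funext hRper
      have h2 := deriv_comp_add_const R (2 * Real.pi) x
      rw [h1] at h2
      exact h2.symm
    have hp : Function.Periodic (fun φ => (deriv R φ / R φ) ^ 2) (2 * Real.pi) := by
      intro x
      simp only [hd x, hRper x]
    have h3 := hp.intervalIntegral_add_eq 0 (-Real.pi)
    rw [zero_add, show -Real.pi + 2 * Real.pi = Real.pi by ring] at h3
    exact h3
  rw [hK]
  have hBF : ∀ m, ∃ f, BF f m (j m ^ 2 / R₀ ^ 2) R₀ := fun m =>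
    exists_BF hR₀ (hJsm m) (hJode m) (hjpos m) (hjzero m) (hjfirst m)
  have hmode : ∀ m : ℕ, (m : ℝ) ^ 2 / R₀ ^ 2 ≤ j m ^ 2 / R₀ ^ 2 ∧
      groundEnergy Ω ω x₀ y₀ ≤ j m ^ 2 / R₀ ^ 2 - m * ω
        + (∫ φ in (-Real.pi)..Real.pi, (deriv R φ / R φ) ^ 2)
          * ((j m ^ 2 / R₀ ^ 2 - (m : ℝ) ^ 2 / R₀ ^ 2) / (2 * Real.pi)) := by
    intro m
    obtain ⟨f, hf⟩ := hBF m
    exact mode_bound hΩo hΩb hRC1 hRper hRpos hstar hR₀ hA hf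
  set K := ∫ φ in (-Real.pi)..Real.pi, (deriv R φ / R φ) ^ 2
  have hK0 : 0 ≤ K :=
    intervalIntegral.integral_nonneg (by linarith) fun φ _ => sq_nonneg _
  set bd := (R₀ ^ 2 * ω + Real.sqrt (R₀ ^ 4 * ω ^ 2 + 4 * j 0 ^ 2)) / 2 with hbd
  set T : Set ℝ := {x : ℝ | ∃ m : ℕ, (m : ℝ) ≤ bd ∧
    x = (j m ^ 2 - (m : ℝ) ^ 2) / (2 * Real.pi * R₀ ^ 2)} with hT
  have hTb : BddAbove T := by
    have : T ⊆ (fun m : ℕ => (j m ^ 2 - (m : ℝ) ^ 2) / (2 * Real.pi * R₀ ^ 2)) ''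
        (Set.Iic ⌊bd⌋₊) := by
      rintro x ⟨m, hm, rfl⟩
      exact ⟨m, Nat.le_floor hm, rfl⟩
    exact (((Set.finite_Iic _).image _).subset this).bddAbove
  have hsmall : ∀ m : ℕ, (m : ℝ) ≤ bd →
      groundEnergy Ω ω x₀ y₀ - K * sSup T ≤ j m ^ 2 / R₀ ^ 2 - m * ω := by
    intro m hm
    have h1 : (j m ^ 2 - (m : ℝ) ^ 2) / (2 * Real.pi * R₀ ^ 2) ≤ sSup T :=
      le_csSup hTb ⟨m, hm, rfl⟩
    have h2 := (hmode m).2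
    have e : (j m ^ 2 / R₀ ^ 2 - (m : ℝ) ^ 2 / R₀ ^ 2) / (2 * Real.pi)
        = (j m ^ 2 - (m : ℝ) ^ 2) / (2 * Real.pi * R₀ ^ 2) := by
      field_simp
    rw [e] at h2
    have := mul_le_mul_of_nonneg_left h1 hK0
    linarith
  have hbd0 : 0 ≤ bd := by positivity
  have hall : ∀ m : ℕ, groundEnergy Ω ω x₀ y₀ - K * sSup T ≤ j m ^ 2 / R₀ ^ 2 - m * ω := by
    intro m
    rcases le_or_gt (m : ℝ) bd with hm | hm
    · exact hsmall m hm
    · have h0 := hsmall 0 (by simpa using hbd0)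
      have h1 : Real.sqrt (R₀ ^ 4 * ω ^ 2 + 4 * j 0 ^ 2) < 2 * m - R₀ ^ 2 * ω := by
        rw [hbd] at hm; linarith
      have h2 : R₀ ^ 4 * ω ^ 2 + 4 * j 0 ^ 2 < (2 * m - R₀ ^ 2 * ω) ^ 2 :=
        (Real.sqrt_lt' ((Real.sqrt_nonneg _).trans_lt h1)).1 h1
      have h3 : j 0 ^ 2 ≤ (m : ℝ) ^ 2 - R₀ ^ 2 * (m * ω) := by nlinarith
      have h4 : j 0 ^ 2 / R₀ ^ 2 ≤ (m : ℝ) ^ 2 / R₀ ^ 2 - m * ω := by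
        have : (m : ℝ) ^ 2 / R₀ ^ 2 - m * ω = ((m : ℝ) ^ 2 - R₀ ^ 2 * (m * ω)) / R₀ ^ 2 := by
          field_simp
        rw [this]
        gcongr
      have h5 := (hmode m).1
      simp only [Nat.cast_zero, zero_mul, sub_zero] at h0
      linarith
  have hfin : groundEnergy Ω ω x₀ y₀ - K * sSup T
      ≤ groundEnergy {p : ℝ × ℝ | p.1 ^ 2 + p.2 ^ 2 < R₀ ^ 2} ω 0 0 := by
    refine le_csInf (disk_nonempty ω hR₀) ?_
    rintro E ⟨u, hu, hc, hs, hn, rfl⟩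
    have h1 := lower (L := groundEnergy Ω ω x₀ y₀ - K * sSup T) (hu.of_le (by exact_mod_cast le_top))
      hc hR₀ hs hω (fun m => by
        obtain ⟨f, hf⟩ := hBF m
        exact ⟨f, _, hf, by positivity, hall m⟩)
    have h2 : nrm u = 1 := hn
    rw [h2, mul_one] at h1
    exact h1
  linarith
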